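/- The 10-color Ramsey number of the loose 3-uniform path of length three is 16: R(P;10) = 16. That is, 16 is the least integer n such that every coloring of all 3-element subsets of an n-element set with 10 colors yields a monochromatic copy of P. -/

import Mathlib

/-- `ramseyProp n r` : every coloring of the 3-element subsets of an `n`-element
set with `r` colors yields a monochromatic copy of the loose path `P`, i.e.
seven distinct vertices `a,b,c,d,e,f,g` with `{a,b,c}`, `{c,d,e}`, `{e,f,g}`
all of the same color. -/
def ramseyProp (n r : ℕ) : Prop :=
  ∀ col : Finset (Fin n) → Fin r,
    ∃ a b c d e f g : Fin n,
      List.Pairwise (· ≠ ·) [a, b, c, d, e, f, g] ∧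
      col {a, b, c} = col {c, d, e} ∧ col {c, d, e} = col {e, f, g}

namespace LP
variable {V : Type} [DecidableEq V]

def PF (H : Finset (Finset V)) : Prop :=
  (∀ e ∈ H, e.card = 3) ∧
  ∀ a b c d e f g : V, [a, b, c, d, e, f, g].Nodup →
    {a, b, c} ∈ H → {c, d, e} ∈ H → {e, f, g} ∈ H → False

def CF (H : Finset (Finset V)) : Prop :=
  ∀ x y z a b c : V, [x, y, z, a, b, c].Nodup →
    {x, a, y} ∈ H → {y, b, z} ∈ H → {z, c, x} ∈ H → False

/-- a triangle configuration -/
def CC (H : Finset (Finset V)) (x y z a b c : V) : Prop :=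
  [x, y, z, a, b, c].Nodup ∧ {x, a, y} ∈ H ∧ {y, b, z} ∈ H ∧ {z, c, x} ∈ H

theorem CC.rot {H : Finset (Finset V)} {x y z a b c : V} (h : CC H x y z a b c) :
    CC H y z x b c a := by
  obtain ⟨h1, h2, h3, h4⟩ := h
  exact ⟨by grind, h3, h4, h2⟩

theorem CC.refl {H : Finset (Finset V)} {x y z a b c : V} (h : CC H x y z a b c) :
    CC H y x z a c b := by
  obtain ⟨h1, h2, h3, h4⟩ := h
  refine ⟨by grind, ?_, ?_, ?_⟩
  · rwa [show ({y, a, x} : Finset V) = {x, a, y} by grind]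
  · rwa [show ({x, c, z} : Finset V) = {z, c, x} by grind]
  · rwa [show ({z, b, y} : Finset V) = {y, b, z} by grind]

theorem PF.path {H : Finset (Finset V)} (hP : PF H) {e1 e2 e3 : Finset V}
    (h1 : e1 ∈ H) (h2 : e2 ∈ H) (h3 : e3 ∈ H) (a b c d e f g : V)
    (hn : [a, b, c, d, e, f, g].Nodup)
    (q1 : e1 = {a, b, c}) (q2 : e2 = {c, d, e}) (q3 : e3 = {e, f, g}) : False := by
  subst q1 q2 q3
  exact hP.2 a b c d e f g hn h1 h2 h3

theorem one_x {H : Finset (Finset V)} (hP : PF H) {x y z a b c : V} (h : CC H x y z a b c)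
    {p q : V} (hp : p ∉ ({x, y, z, a, b, c} : Finset V)) (hq : q ∉ ({x, y, z, a, b, c} : Finset V))
    (hpq : p ≠ q) : {x, p, q} ∉ H := by
  obtain ⟨h1, h2, h3, h4⟩ := h
  intro h5
  exact hP.path h5 h2 h3 p q x a y b z (by grind) (by grind) (by grind) (by grind)

theorem one_a {H : Finset (Finset V)} (hP : PF H) {x y z a b c : V} (h : CC H x y z a b c)
    {p q : V} (hp : p ∉ ({x, y, z, a, b, c} : Finset V)) (hq : q ∉ ({x, y, z, a, b, c} : Finset V))
    (hpq : p ≠ q) : {a, p, q} ∉ H := by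
  obtain ⟨h1, h2, h3, h4⟩ := h
  intro h5
  exact hP.path h5 h2 h3 p q a x y b z (by grind) (by grind) (by grind) (by grind)

theorem two_xa {H : Finset (Finset V)} (hP : PF H) {x y z a b c : V} (h : CC H x y z a b c)
    {p : V} (hp : p ∉ ({x, y, z, a, b, c} : Finset V)) : {p, x, a} ∉ H := by
  obtain ⟨h1, h2, h3, h4⟩ := h
  intro h5
  exact hP.path h5 h4 h3 p a x c z b y (by grind) (by grind) (by grind) (by grind)

theorem two_ya {H : Finset (Finset V)} (hP : PF H) {x y z a b c : V} (h : CC H x y z a b c)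
    {p : V} (hp : p ∉ ({x, y, z, a, b, c} : Finset V)) : {p, y, a} ∉ H := by
  obtain ⟨h1, h2, h3, h4⟩ := h
  intro h5
  exact hP.path h5 h3 h4 p a y b z c x (by grind) (by grind) (by grind) (by grind)

theorem two_ab {H : Finset (Finset V)} (hP : PF H) {x y z a b c : V} (h : CC H x y z a b c)
    {p : V} (hp : p ∉ ({x, y, z, a, b, c} : Finset V)) : {p, a, b} ∉ H := by
  obtain ⟨h1, h2, h3, h4⟩ := h
  intro h5
  exact hP.path h5 h2 h4 p b a y x c z (by grind) (by grind) (by grind) (by grind)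

theorem conf {H : Finset (Finset V)} (hP : PF H) {x y z a b c : V} (h : CC H x y z a b c)
    {p q : V} (hp : p ∉ ({x, y, z, a, b, c} : Finset V)) (hq : q ∉ ({x, y, z, a, b, c} : Finset V))
    (hpq : p ≠ q) (h5 : {p, a, z} ∈ H) (h6 : {q, x, y} ∈ H) : False := by
  obtain ⟨h1, h2, h3, h4⟩ := h
  exact hP.path h5 h3 h6 p a z b y x q (by grind) (by grind) (by grind) (by grind)

/-- edges off `S` avoid attached vertices -/
theorem off_xy {H : Finset (Finset V)} (hP : PF H) {x y z a b c : V} (h : CC H x y z a b c)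
    {p s t : V} (hp : p ∉ ({x, y, z, a, b, c} : Finset V)) (hs : s ∉ ({x, y, z, a, b, c} : Finset V))
    (ht : t ∉ ({x, y, z, a, b, c} : Finset V)) (hd : [p, s, t].Nodup)
    (h5 : {p, x, y} ∈ H) : {p, s, t} ∉ H := by
  obtain ⟨h1, h2, h3, h4⟩ := h
  intro h6
  exact hP.path h6 h5 h3 s t p x y b z (by grind) (by grind) (by grind) (by grind)

theorem off_az {H : Finset (Finset V)} (hP : PF H) {x y z a b c : V} (h : CC H x y z a b c)
    {p s t : V} (hp : p ∉ ({x, y, z, a, b, c} : Finset V)) (hs : s ∉ ({x, y, z, a, b, c} : Finset V))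
    (ht : t ∉ ({x, y, z, a, b, c} : Finset V)) (hd : [p, s, t].Nodup)
    (h5 : {p, a, z} ∈ H) : {p, s, t} ∉ H := by
  obtain ⟨h1, h2, h3, h4⟩ := h
  intro h6
  exact hP.path h6 h5 h3 s t p a z b y (by grind) (by grind) (by grind) (by grind)

end LP

namespace LP
variable {V : Type} [DecidableEq V]

theorem split1 {e : Finset V} {c : V} (h : e.card = 3) (hc : c ∈ e) :
    ∃ a b, a ≠ b ∧ a ≠ c ∧ b ≠ c ∧ e = {a, b, c} := by
  have h2 : (e.erase c).card = 2 := by rw [Finset.card_erase_of_mem hc, h]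
  obtain ⟨a, b, hab, h3⟩ := Finset.card_eq_two.1 h2
  have ha : a ∈ e.erase c := by rw [h3]; simp
  have hb : b ∈ e.erase c := by rw [h3]; simp
  refine ⟨a, b, hab, (Finset.mem_erase.1 ha).1, (Finset.mem_erase.1 hb).1, ?_⟩
  rw [← Finset.insert_erase hc, h3]
  grind

theorem split2 {e : Finset V} {c d : V} (h : e.card = 3) (hc : c ∈ e) (hd : d ∈ e) (hcd : c ≠ d) :
    ∃ a, a ≠ c ∧ a ≠ d ∧ e = {c, a, d} := by
  obtain ⟨a, b, hab, hac, hbc, rfl⟩ := split1 h hc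
  have : d = a ∨ d = b := by grind
  rcases this with rfl | rfl
  · exact ⟨b, hbc, by grind, by grind⟩
  · exact ⟨a, by grind, by grind, by grind⟩

theorem PF.sets {H : Finset (Finset V)} (hP : PF H) {e1 e2 e3 : Finset V}
    (h1 : e1 ∈ H) (h2 : e2 ∈ H) (h3 : e3 ∈ H) (h12 : (e1 ∩ e2).card = 1)
    (h23 : (e2 ∩ e3).card = 1) (h13 : Disjoint e1 e3) : False := by
  obtain ⟨c, hc⟩ := Finset.card_eq_one.1 h12
  obtain ⟨e, he⟩ := Finset.card_eq_one.1 h23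
  have hc' : c ∈ e1 ∩ e2 := by rw [hc]; simp
  have he' : e ∈ e2 ∩ e3 := by rw [he]; simp
  rw [Finset.mem_inter] at hc' he'
  have hce : c ≠ e := by
    rintro rfl; exact Finset.disjoint_left.1 h13 hc'.1 he'.2
  obtain ⟨a, b, hab, hac, hbc, q1⟩ := split1 (hP.1 _ h1) hc'.1
  obtain ⟨d, hdc, hde, q2⟩ := split2 (hP.1 _ h2) hc'.2 he'.1 hce
  obtain ⟨f, g, hfg, hfe, hge, q3⟩ := split1 (hP.1 _ h3) he'.2
  have k1 : ∀ t, t ∈ e1 → t ∈ e2 → t = c := by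
    intro t ht1 ht2
    have : t ∈ e1 ∩ e2 := by simp [ht1, ht2]
    rw [hc] at this; simpa using this
  have k2 : ∀ t, t ∈ e2 → t ∈ e3 → t = e := by
    intro t ht1 ht2
    have : t ∈ e2 ∩ e3 := by simp [ht1, ht2]
    rw [he] at this; simpa using this
  have k3 : ∀ t, t ∈ e1 → t ∈ e3 → False := fun t => fun u v => Finset.disjoint_left.1 h13 u v
  have a1 : a ∈ e1 := by simp [q1]
  have b1 : b ∈ e1 := by simp [q1]
  have d2 : d ∈ e2 := by simp [q2]
  have f3 : f ∈ e3 := by simp [q3]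
  have g3 : g ∈ e3 := by simp [q3]
  refine hP.path h1 h2 h3 a b c d e f g ?_ q1 q2 (by rw [q3]; clear * -; grind)
  clear h12 h23 h13 hP hc he h1 h2 h3
  grind

theorem CF.sets {H : Finset (Finset V)} (hP : PF H) (hC : CF H) {e1 e2 e3 : Finset V}
    (h1 : e1 ∈ H) (h2 : e2 ∈ H) (h3 : e3 ∈ H) (x y z : V) (hxy : x ≠ y) (hyz : y ≠ z) (hxz : x ≠ z)
    (h12 : e1 ∩ e2 = {y}) (h23 : e2 ∩ e3 = {z}) (h13 : e1 ∩ e3 = {x}) : False := by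
  have k1 : ∀ t, t ∈ e1 ∧ t ∈ e2 ↔ t = y := by
    intro t; rw [← Finset.mem_inter, h12]; simp
  have k2 : ∀ t, t ∈ e2 ∧ t ∈ e3 ↔ t = z := by
    intro t; rw [← Finset.mem_inter, h23]; simp
  have k3 : ∀ t, t ∈ e1 ∧ t ∈ e3 ↔ t = x := by
    intro t; rw [← Finset.mem_inter, h13]; simp
  obtain ⟨a, ha1, ha2, q1⟩ := split2 (hP.1 _ h1) ((k3 x).2 rfl).1 ((k1 y).2 rfl).1 hxy
  obtain ⟨b, hb1, hb2, q2⟩ := split2 (hP.1 _ h2) ((k1 y).2 rfl).2 ((k2 z).2 rfl).1 hyz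
  obtain ⟨c, hc1, hc2, q3⟩ := split2 (hP.1 _ h3) ((k2 z).2 rfl).2 ((k3 x).2 rfl).2 hxz.symm
  refine hC x y z a b c ?_ (q1 ▸ h1) (q2 ▸ h2) (q3 ▸ h3)
  have a1 : a ∈ e1 := by simp [q1]
  have b1 : b ∈ e2 := by simp [q2]
  have c1 : c ∈ e3 := by simp [q3]
  grind

theorem one_S {H : Finset (Finset V)} (hP : PF H) {x y z a b c : V} (h : CC H x y z a b c)
    {s p q : V} (hs : s ∈ ({x, y, z, a, b, c} : Finset V))
    (hp : p ∉ ({x, y, z, a, b, c} : Finset V)) (hq : q ∉ ({x, y, z, a, b, c} : Finset V))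
    (hpq : p ≠ q) : {s, p, q} ∉ H := by
  simp only [Finset.mem_insert, Finset.mem_singleton] at hs
  rcases hs with rfl | rfl | rfl | rfl | rfl | rfl
  · exact one_x hP h hp hq hpq
  · exact one_x hP h.rot (by grind) (by grind) hpq
  · exact one_x hP h.rot.rot (by grind) (by grind) hpq
  · exact one_a hP h hp hq hpq
  · exact one_a hP h.rot (by grind) (by grind) hpq
  · exact one_a hP h.rot.rot (by grind) (by grind) hpq

def sixA (x y z p : V) : Finset (Finset V) := {{p, x, y}, {p, y, z}, {p, z, x}}
def sixB (x y z a b c p : V) : Finset (Finset V) := {{p, a, z}, {p, b, x}, {p, c, y}}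

theorem two_S {H : Finset (Finset V)} (hP : PF H) {x y z a b c : V} (h : CC H x y z a b c)
    {s t p : V} (hs : s ∈ ({x, y, z, a, b, c} : Finset V))
    (ht : t ∈ ({x, y, z, a, b, c} : Finset V)) (hst : s ≠ t)
    (hp : p ∉ ({x, y, z, a, b, c} : Finset V)) (he : {p, s, t} ∈ H) :
    {p, s, t} ∈ sixA x y z p ∨ {p, s, t} ∈ sixB x y z a b c p := by
  have comm : ∀ u v : V, ({p, u, v} : Finset V) = {p, v, u} := by intro u v; grind
  have f1 := two_xa hP h hp
  have f2 := two_ya hP h hp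
  have f3 := two_ab hP h hp
  have f4 := two_xa hP h.rot (p := p) (by grind)
  have f5 := two_ya hP h.rot (p := p) (by grind)
  have f6 := two_ab hP h.rot (p := p) (by grind)
  have f7 := two_xa hP h.rot.rot (p := p) (by grind)
  have f8 := two_ya hP h.rot.rot (p := p) (by grind)
  have f9 := two_ab hP h.rot.rot (p := p) (by grind)
  simp only [sixA, sixB, Finset.mem_insert, Finset.mem_singleton] at hs ht ⊢
  rcases hs with rfl | rfl | rfl | rfl | rfl | rfl <;> rcases ht with rfl | rfl | rfl | rfl | rfl | rfl <;>
    first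
    | exact absurd rfl hst
    | exact absurd he ‹_›
    | exact absurd (comm _ _ ▸ he) ‹_›
    | simp
    | (rw [comm]; simp)

theorem tri_S {H : Finset (Finset V)} (hP : PF H) {x y z a b c : V} (h : CC H x y z a b c)
    {e : Finset V} (he : e ∈ H) :
    e ⊆ {x, y, z, a, b, c} ∨ Disjoint e {x, y, z, a, b, c} ∨
    ∃ p ∉ ({x, y, z, a, b, c} : Finset V), p ∈ e ∧ (e ∈ sixA x y z p ∨ e ∈ sixB x y z a b c p) := by
  obtain ⟨r, s, t, hrs, hrt, hst, rfl⟩ := Finset.card_eq_three.1 (hP.1 e he)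
  have e1 : ({r, s, t} : Finset V) = {s, r, t} := by grind
  have e2 : ({r, s, t} : Finset V) = {t, r, s} := by grind
  by_cases hr : r ∈ ({x, y, z, a, b, c} : Finset V) <;>
  by_cases hs : s ∈ ({x, y, z, a, b, c} : Finset V) <;>
  by_cases ht : t ∈ ({x, y, z, a, b, c} : Finset V)
  · left
    intro u hu
    simp only [Finset.mem_insert, Finset.mem_singleton] at hu
    rcases hu with rfl | rfl | rfl <;> assumption
  · right; right
    rw [e2] at he ⊢
    exact ⟨t, ht, by simp, two_S hP h hr hs hrs ht he⟩
  · right; right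
    rw [e1] at he ⊢
    exact ⟨s, hs, by simp, two_S hP h hr ht hrt hs he⟩
  · exact absurd he (one_S hP h hr hs ht hst)
  · right; right
    exact ⟨r, hr, by simp, two_S hP h hs ht hst hr he⟩
  · exact absurd (e1 ▸ he) (one_S hP h hs hr ht hrt)
  · exact absurd (e2 ▸ he) (one_S hP h ht hr hs hrs)
  · right; left
    rw [Finset.disjoint_left]
    intro u hu
    simp only [Finset.mem_insert, Finset.mem_singleton] at hu
    rcases hu with rfl | rfl | rfl <;> assumption

theorem comp6 {e f : Finset V} {u1 u2 u3 u4 u5 u6 : V} (hn : [u1, u2, u3, u4, u5, u6].Nodup)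
    (ke : ∀ u, (u ∈ e ∨ u ∈ f) ↔ (u = u1 ∨ u = u2 ∨ u = u3 ∨ u = u4 ∨ u = u5 ∨ u = u6))
    (kd : ∀ u, u ∈ e → u ∉ f) (he : e = {u1, u2, u3}) : f = {u4, u5, u6} := by
  ext u
  have k1 := ke u
  have k2 := kd u
  subst he
  simp only [Finset.mem_insert, Finset.mem_singleton] at *
  grind

set_option maxHeartbeats 2000000 in
theorem compl_xy {H : Finset (Finset V)} (hP : PF H) {x y z a b c : V} (h : CC H x y z a b c)
    {p : V} (hp : p ∉ ({x, y, z, a, b, c} : Finset V))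
    (hxy : {p, x, y} ∈ H) {e f : Finset V} (he : e ∈ H) (hf : f ∈ H) (kd : ∀ u, u ∈ e → u ∉ f)
    (ke : ∀ u, (u ∈ e ∨ u ∈ f) ↔ (u = x ∨ u = y ∨ u = z ∨ u = a ∨ u = b ∨ u = c)) (hx : x ∈ e) :
    e = {x, y, a} := by
  obtain ⟨h1, h2, h3, h4⟩ := h
  have ce := hP.1 e he
  by_cases hy : y ∈ e
  · obtain ⟨t, ht1, ht2, q⟩ := split2 ce hx hy (by grind)
    have ht : t = z ∨ t = a ∨ t = b ∨ t = c := by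
      have := (ke t).1 (Or.inl (by simp [q])); tauto
    rcases ht with rfl | rfl | rfl | rfl
    · exfalso
      have qf : f = {c, a, b} := comp6 (u1 := x) (u2 := t) (u3 := y) (by clear ke kd; grind)
        (by intro u; rw [ke]; tauto) kd q
      clear ke kd ce
      exact hP.path hf h3 hxy c a b t y x p (by grind) (by grind) (by grind) (by grind)
    · rw [q]; clear * -; grind
    · exfalso
      have qf : f = {a, c, z} := comp6 (u1 := x) (u2 := t) (u3 := y) (by clear ke kd; grind)
        (by intro u; rw [ke]; tauto) kd q
      clear ke kd ce
      exact hP.path hf h3 hxy a c z t y x p (by grind) (by grind) (by grind) (by grind)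
    · exfalso
      have qf : f = {a, b, z} := comp6 (u1 := x) (u2 := t) (u3 := y) (by clear ke kd; grind)
        (by intro u; rw [ke]; tauto) kd q
      clear ke kd ce
      exact hP.path hf h4 hxy a b z t x y p (by grind) (by grind) (by grind) (by grind)
  · exfalso
    refine hP.sets he hxy hf ?_ ?_ (Finset.disjoint_left.2 kd)
    · rw [show e ∩ {p, x, y} = {x} by ext u; have := ke u; grind]; simp
    · rw [show {p, x, y} ∩ f = {y} by ext u; have := ke u; have := ke y; grind]; simp

set_option maxHeartbeats 2000000 in
theorem compl_az {H : Finset (Finset V)} (hP : PF H) {x y z a b c : V} (h : CC H x y z a b c)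
    {p : V} (hp : p ∉ ({x, y, z, a, b, c} : Finset V))
    (haz : {p, a, z} ∈ H) {e f : Finset V} (he : e ∈ H) (hf : f ∈ H) (kd : ∀ u, u ∈ e → u ∉ f)
    (ke : ∀ u, (u ∈ e ∨ u ∈ f) ↔ (u = x ∨ u = y ∨ u = z ∨ u = a ∨ u = b ∨ u = c)) (ha : a ∈ e) :
    False := by
  obtain ⟨h1, h2, h3, h4⟩ := h
  have ce := hP.1 e he
  by_cases hy : z ∈ e
  · obtain ⟨t, ht1, ht2, q⟩ := split2 ce ha hy (by grind)
    have ht : t = x ∨ t = y ∨ t = b ∨ t = c := by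
      have := (ke t).1 (Or.inl (by simp [q])); tauto
    rcases ht with rfl | rfl | rfl | rfl
    · have qf : f = {b, c, y} := comp6 (u1 := a) (u2 := t) (u3 := z) (by clear ke kd; grind)
        (by intro u; rw [ke]; tauto) kd q
      clear ke kd ce
      exact hP.path hf h2 haz b c y t a z p (by grind) (by grind) (by grind) (by grind)
    · have qf : f = {b, c, x} := comp6 (u1 := a) (u2 := t) (u3 := z) (by clear ke kd; grind)
        (by intro u; rw [ke]; tauto) kd q
      clear ke kd ce
      exact hP.path hf h2 haz b c x t a z p (by grind) (by grind) (by grind) (by grind)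
    · have qf : f = {x, c, y} := comp6 (u1 := a) (u2 := t) (u3 := z) (by clear ke kd; grind)
        (by intro u; rw [ke]; tauto) kd q
      clear ke kd ce
      exact hP.path hf h3 haz x c y t z a p (by grind) (by grind) (by grind) (by grind)
    · have qf : f = {y, b, x} := comp6 (u1 := a) (u2 := t) (u3 := z) (by clear ke kd; grind)
        (by intro u; rw [ke]; tauto) kd q
      clear ke kd ce
      exact hP.path hf h4 haz y b x t z a p (by grind) (by grind) (by grind) (by grind)
  · refine hP.sets he haz hf ?_ ?_ (Finset.disjoint_left.2 kd)
    · rw [show e ∩ {p, a, z} = {a} by ext u; have := ke u; grind]; simp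
    · rw [show {p, a, z} ∩ f = {z} by ext u; have := ke u; have := ke z; grind]; simp

/-- complementary pairs -/
theorem compl_aux {H : Finset (Finset V)} (hP : PF H) {x y z a b c : V} (h : CC H x y z a b c)
    {p : V} (hp : p ∉ ({x, y, z, a, b, c} : Finset V))
    (h5 : {p, x, y} ∈ H ∨ {p, a, z} ∈ H) {e f : Finset V} (he : e ∈ H) (hf : f ∈ H)
    (kd : ∀ u, u ∈ e → u ∉ f)
    (ke : ∀ u, (u ∈ e ∨ u ∈ f) ↔ (u = x ∨ u = y ∨ u = z ∨ u = a ∨ u = b ∨ u = c)) :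
    e = {x, y, a} ∨ e = {z, b, c} := by
  have kd' : ∀ u, u ∈ f → u ∉ e := fun u hu hv => kd u hv hu
  have ke' : ∀ u, (u ∈ f ∨ u ∈ e) ↔ (u = x ∨ u = y ∨ u = z ∨ u = a ∨ u = b ∨ u = c) := by
    intro u; rw [← ke]; tauto
  rcases h5 with h5 | h5
  · by_cases hx : x ∈ e
    · exact Or.inl (compl_xy hP h hp h5 he hf kd ke hx)
    · have hx : x ∈ f := by have := ke x; tauto
      have := compl_xy hP h hp h5 hf he kd' ke' hx
      right
      have hn := h.1
      exact comp6 (u1 := x) (u2 := y) (u3 := a) (by clear * - hn; grind)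
        (by intro u; rw [ke']; tauto) kd' this
  · by_cases hx : a ∈ e
    · exact (compl_az hP h hp h5 he hf kd ke hx).elim
    · have hx : a ∈ f := by have := ke a; tauto
      exact (compl_az hP h hp h5 hf he kd' ke' hx).elim
end LP

namespace LP
variable {V : Type} [DecidableEq V]

theorem card_six {x y z a b c : V} (hn : [x, y, z, a, b, c].Nodup) :
    ({x, y, z, a, b, c} : Finset V).card = 6 := by
  have := List.toFinset_card_of_nodup hn
  simpa using this

set_option maxHeartbeats 1000000 in
theorem K11 {H : Finset (Finset V)} (hP : PF H) {x y z a b c : V} (h : CC H x y z a b c)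
    {p : V} (hp : p ∉ ({x, y, z, a, b, c} : Finset V))
    (h5 : {p, x, y} ∈ H ∨ {p, a, z} ∈ H) :
    (H.filter (· ⊆ ({x, y, z, a, b, c} : Finset V))).card ≤ 11 := by
  have hn := h.1
  have hS := card_six hn
  set S : Finset V := {x, y, z, a, b, c} with hSdef
  have memS : ∀ u, u ∈ S ↔ (u = x ∨ u = y ∨ u = z ∨ u = a ∨ u = b ∨ u = c) := by
    intro u; simp [hSdef]
  set K := H.filter (· ⊆ S) with hK
  let E : Finset (Finset V) := {{x, y, a}, {z, b, c}}
  have hE2 : E.card = 2 := by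
    apply Finset.card_pair
    intro hh
    have : x ∈ ({z, b, c} : Finset V) := by rw [← hh]; simp
    clear * - this hn
    simp at hn this
    grind
  have hEc : ∀ e ∈ E, e.card = 3 ∧ e ⊆ S := by
    intro e he
    simp only [E, Finset.mem_insert, Finset.mem_singleton] at he
    rcases he with rfl | rfl
    · refine ⟨Finset.card_eq_three.2 ⟨x, y, a, ?_, ?_, ?_, rfl⟩, ?_⟩
      · clear * - hn; simp at hn ⊢; grind
      · clear * - hn; simp at hn ⊢; grind
      · clear * - hn; simp at hn ⊢; grind
      · intro u hu; rw [memS]; simp at hu; clear * - hu; grind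
    · refine ⟨Finset.card_eq_three.2 ⟨z, b, c, ?_, ?_, ?_, rfl⟩, ?_⟩
      · clear * - hn; simp at hn ⊢; grind
      · clear * - hn; simp at hn ⊢; grind
      · clear * - hn; simp at hn ⊢; grind
      · intro u hu; rw [memS]; simp at hu; clear * - hu; grind
  have hcompl : ∀ e ⊆ S, S \ e ∈ E → e ∈ E := by
    intro e he hse
    have kd : ∀ u, u ∈ S \ e → u ∉ e := fun u hu => (Finset.mem_sdiff.1 hu).2
    have ke : ∀ u, (u ∈ S \ e ∨ u ∈ e) ↔ u ∈ S := by
      intro u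
      rw [Finset.mem_sdiff]
      have := @he u
      clear * - this
      grind
    simp only [E, Finset.mem_insert, Finset.mem_singleton] at hse ⊢
    rcases hse with hse | hse
    · right
      refine comp6 (u1 := x) (u2 := y) (u3 := a) ?_ ?_ kd hse
      · clear * - hn; simp at hn ⊢; grind
      · intro u; rw [ke, memS]; clear * -; grind
    · left
      refine comp6 (u1 := z) (u2 := b) (u3 := c) ?_ ?_ kd hse
      · clear * - hn; simp at hn ⊢; grind
      · intro u; rw [ke, memS]; clear * -; grind
  set T := Finset.powersetCard 3 S with hT
  have hT20 : T.card = 20 := by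
    rw [hT, Finset.card_powersetCard, hS]; rfl
  have hET : E ⊆ T := by
    intro e he
    rw [hT, Finset.mem_powersetCard]
    exact ⟨(hEc e he).2, (hEc e he).1⟩
  have hTE : (T \ E).card = 18 := by
    rw [Finset.card_sdiff_of_subset hET, hT20, hE2]
  have hKprop : ∀ e ∈ K, e ∈ H ∧ e ⊆ S ∧ e.card = 3 := by
    intro e he
    rw [hK, Finset.mem_filter] at he
    exact ⟨he.1, he.2, hP.1 e he.1⟩
  have hKE : K.card ≤ (K \ E).card + 2 := by
    have := Finset.le_card_sdiff E K
    omega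
  let I := (K \ E).image (fun e => S \ e)
  have hI : I.card = (K \ E).card := by
    apply Finset.card_image_of_injOn
    intro e he f hf hef
    have he' := (hKprop e (Finset.mem_sdiff.1 he).1).2.1
    have hf' := (hKprop f (Finset.mem_sdiff.1 hf).1).2.1
    simp only at hef
    rw [← Finset.sdiff_sdiff_eq_self he', hef, Finset.sdiff_sdiff_eq_self hf']
  have hdis : Disjoint (K \ E) I := by
    rw [Finset.disjoint_left]
    intro e he heI
    obtain ⟨f, hf, rfl⟩ := Finset.mem_image.1 heI
    rw [Finset.mem_sdiff] at he hf
    obtain ⟨f1, f2, f3⟩ := hKprop f hf.1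
    obtain ⟨g1, g2, g3⟩ := hKprop _ he.1
    apply hf.2
    have := compl_aux hP h hp h5 f1 g1 (fun u hu hv => (Finset.mem_sdiff.1 hv).2 hu)
      (by intro u; rw [← memS, Finset.mem_sdiff]; have := @f2 u; clear * - this; grind)
    simpa [E] using this
  have hsub : (K \ E) ∪ I ⊆ T \ E := by
    intro e he
    rw [Finset.mem_union] at he
    rw [Finset.mem_sdiff, hT, Finset.mem_powersetCard]
    rcases he with he | he
    · rw [Finset.mem_sdiff] at he
      obtain ⟨f1, f2, f3⟩ := hKprop e he.1
      exact ⟨⟨f2, f3⟩, he.2⟩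
    · obtain ⟨f, hf, rfl⟩ := Finset.mem_image.1 he
      rw [Finset.mem_sdiff] at hf
      obtain ⟨f1, f2, f3⟩ := hKprop f hf.1
      refine ⟨⟨Finset.sdiff_subset, ?_⟩, fun hh => hf.2 (hcompl f f2 hh)⟩
      rw [Finset.card_sdiff_of_subset f2, hS, f3]
  have := Finset.card_le_card hsub
  rw [Finset.card_union_of_disjoint hdis, hI, hTE] at this
  omega

theorem sum6 {ι : Type} [DecidableEq ι] (Q : Finset ι) (f : ι → ℕ) (h6 : ∀ p ∈ Q, f p ≤ 6)
    (h : ∀ p ∈ Q, ∀ q ∈ Q, p ≠ q → f p + f q ≤ 6) : ∑ p ∈ Q, f p ≤ 3 * Q.card + 3 := by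
  by_cases hp : ∃ p ∈ Q, 4 ≤ f p
  · obtain ⟨p, hp, h4⟩ := hp
    rw [← Finset.add_sum_erase Q f hp]
    have : ∑ q ∈ Q.erase p, f q ≤ ∑ q ∈ Q.erase p, 2 := by
      apply Finset.sum_le_sum
      intro q hq
      rw [Finset.mem_erase] at hq
      have := h p hp q hq.2 hq.1.symm
      omega
    rw [Finset.sum_const, Finset.card_erase_of_mem hp, smul_eq_mul] at this
    have h1 := h6 p hp
    have : 0 < Q.card := Finset.card_pos.2 ⟨p, hp⟩
    omega
  · push Not at hp
    have : ∑ q ∈ Q, f q ≤ ∑ q ∈ Q, 3 := by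
      apply Finset.sum_le_sum
      intro q hq
      have := hp q hq
      omega
    rw [Finset.sum_const, smul_eq_mul] at this
    omega

theorem inter3 {ι : Type} [DecidableEq ι] (H : Finset ι) (s1 s2 s3 : ι) :
    (H ∩ {s1, s2, s3}).card ≤
      (if s1 ∈ H then 1 else 0) + (if s2 ∈ H then 1 else 0) + (if s3 ∈ H then 1 else 0) := by
  have key : ∀ (s : ι) (T : Finset ι), (H ∩ insert s T).card ≤ (if s ∈ H then 1 else 0) + (H ∩ T).card := by
    intro s T
    rw [Finset.insert_inter]
    split_ifs
    · have := Finset.card_insert_le s (H ∩ T); omega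
    · omega
  have h1 := key s1 {s2, s3}
  have h2 := key s2 {s3}
  have h3 := key s3 ∅
  simp only [Finset.inter_empty, Finset.card_empty, insert_empty_eq] at h3
  omega

theorem inter3_cross {ι : Type} [DecidableEq ι] (H : Finset ι) (s1 s2 s3 t1 t2 t3 : ι)
    (h1 : s1 ∈ H → t1 ∉ H) (h2 : s2 ∈ H → t2 ∉ H) (h3 : s3 ∈ H → t3 ∉ H) :
    (H ∩ {s1, s2, s3}).card + (H ∩ {t1, t2, t3}).card ≤ 3 := by
  have k1 := inter3 H s1 s2 s3
  have k2 := inter3 H t1 t2 t3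
  split_ifs at k1 k2 <;> first | omega | tauto

set_option maxHeartbeats 1000000 in
theorem caseC {H : Finset (Finset V)} (hP : PF H) {U : Finset V} (hU : ∀ e ∈ H, e ⊆ U)
    (X : ℕ → ℕ)
    (hX : ∀ U' ⊆ U, U'.card < U.card → ∀ H' ⊆ H, (∀ e ∈ H', e ⊆ U') → H'.card ≤ X U'.card)
    {x y z a b c : V} (h : CC H x y z a b c) :
    (∃ S ⊆ U, S.card = 6 ∧ ∀ e ∈ H, e ⊆ S ∨ Disjoint e S) ∨
    ∃ u, 7 ≤ u ∧ u ≤ U.card ∧ H.card + 4 ≤ 3 * u + X (U.card - u) := by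
  have hn := h.1
  have hS := card_six hn
  set S : Finset V := {x, y, z, a, b, c} with hSdef
  have hSU : S ⊆ U := by
    intro u hu
    have h1 := hU _ h.2.1
    have h2 := hU _ h.2.2.1
    have h3 := hU _ h.2.2.2
    simp only [hSdef, Finset.mem_insert, Finset.mem_singleton] at hu
    rcases hu with rfl | rfl | rfl | rfl | rfl | rfl
    · exact h1 (by simp)
    · exact h1 (by simp)
    · exact h2 (by simp)
    · exact h1 (by simp)
    · exact h2 (by simp)
    · exact h3 (by simp)
  let T : V → Finset (Finset V) := fun p => H ∩ (sixA x y z p ∪ sixB x y z a b c p)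
  set Q := (U \ S).filter (fun p => (T p).Nonempty) with hQ
  have rotS : ∀ p, p ∉ S → p ∉ ({y, z, x, b, c, a} : Finset V) ∧ p ∉ ({z, x, y, c, a, b} : Finset V) := by
    intro p hp
    simp only [hSdef, Finset.mem_insert, Finset.mem_singleton] at hp ⊢
    clear * - hp
    grind
  have tri : ∀ e ∈ H, e ⊆ S ∨ Disjoint e S ∨ ∃ p ∈ Q, e ∈ T p := by
    intro e he
    rcases tri_S hP h he with h1 | h1 | ⟨p, hp, hpe, h1⟩
    · exact Or.inl h1
    · exact Or.inr (Or.inl h1)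
    · right; right
      have : e ∈ T p := by simp only [T, Finset.mem_inter, Finset.mem_union]; exact ⟨he, h1⟩
      exact ⟨p, by rw [hQ, Finset.mem_filter, Finset.mem_sdiff]; exact ⟨⟨hU e he hpe, hp⟩, ⟨e, this⟩⟩, this⟩
  by_cases hQe : Q = ∅
  · left
    refine ⟨S, hSU, hS, fun e he => ?_⟩
    rcases tri e he with h1 | h1 | ⟨p, hp, _⟩
    · exact Or.inl h1
    · exact Or.inr h1
    · simp [hQe] at hp
  right
  have hQprop : ∀ p ∈ Q, p ∈ U ∧ p ∉ S ∧ (({p, x, y} ∈ H ∨ {p, a, z} ∈ H) ∨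
      ({p, y, z} ∈ H ∨ {p, b, x} ∈ H) ∨ ({p, z, x} ∈ H ∨ {p, c, y} ∈ H)) := by
    intro p hp
    rw [hQ, Finset.mem_filter, Finset.mem_sdiff] at hp
    refine ⟨hp.1.1, hp.1.2, ?_⟩
    obtain ⟨e, he⟩ := hp.2
    simp only [T, sixA, sixB, Finset.mem_inter, Finset.mem_union, Finset.mem_insert,
      Finset.mem_singleton] at he
    obtain ⟨he, (rfl | rfl | rfl) | (rfl | rfl | rfl)⟩ := he <;> tauto
  have hSr : ({y, z, x, b, c, a} : Finset V) = S := by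
    rw [hSdef]; clear * -; grind
  have hSrr : ({z, x, y, c, a, b} : Finset V) = S := by
    rw [hSdef]; clear * -; grind
  have hK : (H.filter (· ⊆ S)).card ≤ 11 := by
    obtain ⟨p, hp⟩ := Finset.nonempty_iff_ne_empty.2 hQe
    obtain ⟨_, h2, h3 | h3 | h3⟩ := hQprop p hp
    · exact K11 hP h h2 h3
    · have := K11 hP h.rot (rotS p h2).1 h3
      rwa [hSr] at this
    · have := K11 hP h.rot.rot (rotS p h2).2 h3
      rwa [hSrr] at this
  have hoff : ∀ e ∈ H, Disjoint e S → Disjoint e Q := by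
    intro e he hd
    rw [Finset.disjoint_left]
    intro p hpe hpQ
    obtain ⟨_, h2, h3⟩ := hQprop p hpQ
    obtain ⟨s, t, hst, hsp, htp, rfl⟩ := split1 (hP.1 e he) hpe
    have hs : s ∉ S := Finset.disjoint_left.1 hd (by simp)
    have ht : t ∉ S := Finset.disjoint_left.1 hd (by simp)
    have hnd : [p, s, t].Nodup := by simp; tauto
    have he' : {p, s, t} ∈ H := by
      rwa [show ({p, s, t} : Finset V) = {s, t, p} by clear * -; grind]
    rcases h3 with (h3 | h3) | (h3 | h3) | (h3 | h3)
    · exact off_xy hP h h2 hs ht hnd h3 he'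
    · exact off_az hP h h2 hs ht hnd h3 he'
    · exact off_xy hP h.rot (rotS p h2).1 (rotS s hs).1 (rotS t ht).1 hnd h3 he'
    · exact off_az hP h.rot (rotS p h2).1 (rotS s hs).1 (rotS t ht).1 hnd h3 he'
    · exact off_xy hP h.rot.rot (rotS p h2).2 (rotS s hs).2 (rotS t ht).2 hnd h3 he'
    · exact off_az hP h.rot.rot (rotS p h2).2 (rotS s hs).2 (rotS t ht).2 hnd h3 he'
  have hcross : ∀ p ∉ S, ∀ q ∉ S, p ≠ q → (H ∩ sixB x y z a b c p).card + (H ∩ sixA x y z q).card ≤ 3 := by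
    intro p hp q hq hpq
    apply inter3_cross
    · intro h1 h2
      exact conf hP h hp hq hpq h1 h2
    · intro h1 h2
      exact conf hP h.rot (rotS p hp).1 (rotS q hq).1 hpq h1 h2
    · intro h1 h2
      exact conf hP h.rot.rot (rotS p hp).2 (rotS q hq).2 hpq h1 h2
  have hTle : ∀ p, (T p).card ≤ (H ∩ sixA x y z p).card + (H ∩ sixB x y z a b c p).card := by
    intro p
    simp only [T]
    rw [Finset.inter_union_distrib_left]
    exact Finset.card_union_le _ _
  have h33 : ∀ p, (H ∩ sixA x y z p).card ≤ 3 ∧ (H ∩ sixB x y z a b c p).card ≤ 3 := by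
    intro p
    exact ⟨(Finset.card_le_card Finset.inter_subset_right).trans Finset.card_le_three,
      (Finset.card_le_card Finset.inter_subset_right).trans Finset.card_le_three⟩
  have hsum : ∑ p ∈ Q, (T p).card ≤ 3 * Q.card + 3 := by
    apply sum6
    · intro p hp
      have := hTle p; have := h33 p; omega
    · intro p hp q hq hpq
      have k1 := hcross p (hQprop p hp).2.1 q (hQprop q hq).2.1 hpq
      have k2 := hcross q (hQprop q hq).2.1 p (hQprop p hp).2.1 hpq.symm
      have := hTle p; have := hTle q
      omega
  have hQS : Q ⊆ U \ S := by rw [hQ]; exact Finset.filter_subset _ _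
  have hUS : (U \ S).card + 6 = U.card := by
    rw [← hS]; exact Finset.card_sdiff_add_card_eq_card hSU
  have hUSQ : ((U \ S) \ Q).card + Q.card = (U \ S).card := Finset.card_sdiff_add_card_eq_card hQS
  have hQpos : 0 < Q.card := Finset.card_pos.2 (Finset.nonempty_iff_ne_empty.2 hQe)
  set O := H.filter (· ⊆ (U \ S) \ Q) with hO
  have hOc : O.card ≤ X ((U \ S) \ Q).card := by
    apply hX _ (Finset.sdiff_subset.trans Finset.sdiff_subset) (by omega) _ (Finset.filter_subset _ _)
    intro e he
    exact (Finset.mem_filter.1 he).2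
  have hcov : H ⊆ H.filter (· ⊆ S) ∪ (O ∪ Q.biUnion T) := by
    intro e he
    simp only [Finset.mem_union, Finset.mem_biUnion]
    rcases tri e he with h1 | h1 | h1
    · left; rw [Finset.mem_filter]; exact ⟨he, h1⟩
    · right; left; rw [hO, Finset.mem_filter]
      refine ⟨he, fun u hu => ?_⟩
      rw [Finset.mem_sdiff, Finset.mem_sdiff]
      exact ⟨⟨hU e he hu, Finset.disjoint_left.1 h1 hu⟩, Finset.disjoint_left.1 (hoff e he h1) hu⟩
    · right; right; exact h1
  have h1 := Finset.card_le_card hcov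
  have h2 := Finset.card_union_le (H.filter (· ⊆ S)) (O ∪ Q.biUnion T)
  have h3 := Finset.card_union_le O (Q.biUnion T)
  have h4 : (Q.biUnion T).card ≤ ∑ p ∈ Q, (T p).card := Finset.card_biUnion_le
  refine ⟨6 + Q.card, by omega, by omega, ?_⟩
  rw [show U.card - (6 + Q.card) = ((U \ S) \ Q).card by omega]
  omega

end LP

namespace LP
variable {V : Type} [DecidableEq V]

theorem oddtown (U : Finset V) (F : Finset (Finset V)) (hU : ∀ e ∈ F, e ⊆ U)
    (hodd : ∀ e ∈ F, e.card = 3) (heven : ∀ e ∈ F, ∀ f ∈ F, e ≠ f → Even (e ∩ f).card) :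
    F.card ≤ U.card := by
  let w : F → (U → ZMod 2) := fun e u => if u.1 ∈ e.1 then 1 else 0
  have dot : ∀ e f : F, ∑ u : U, w e u * w f u = ((e.1 ∩ f.1).card : ZMod 2) := by
    intro e f
    have h1 : ∀ u : U, w e u * w f u = (fun a : V => if a ∈ e.1 ∩ f.1 then (1 : ZMod 2) else 0) u.1 := by
      intro u
      simp only [w, Finset.mem_inter]
      split_ifs <;> simp_all
    rw [Finset.sum_congr rfl (fun u _ => h1 u), Finset.sum_coe_sort U
      (fun a : V => if a ∈ e.1 ∩ f.1 then (1 : ZMod 2) else 0)]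
    rw [Finset.sum_ite_mem]
    rw [Finset.inter_eq_right.2 (Finset.inter_subset_left.trans (hU e.1 e.2))]
    simp
  have hli : LinearIndependent (ZMod 2) w := by
    rw [Fintype.linearIndependent_iff]
    intro g hg f
    have h2 : ∑ u : U, (∑ e : F, g e • w e) u * w f u = 0 := by
      rw [hg]; simp
    have h3 : ∑ u : U, (∑ e : F, g e • w e) u * w f u = ∑ e : F, g e * ∑ u : U, w e u * w f u := by
      simp only [Finset.sum_apply, Pi.smul_apply, smul_eq_mul, Finset.sum_mul, Finset.mul_sum]
      rw [Finset.sum_comm]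
      simp only [mul_assoc]
    rw [h3] at h2
    rw [Finset.sum_eq_single f] at h2
    · rw [dot, Finset.inter_self, hodd f.1 f.2] at h2
      have : ((3 : ℕ) : ZMod 2) = 1 := by decide
      rw [this, mul_one] at h2
      exact h2
    · intro e _ hef
      rw [dot, (ZMod.natCast_eq_zero_iff_even).2 (heven e.1 e.2 f.1 f.2 (fun hh => hef (Subtype.ext hh)))]
      simp
    · simp
  have := hli.fintype_card_le_finrank
  simpa using this

theorem key2 {H : Finset (Finset V)} (hP : PF H) (hC : CF H) {e f g : Finset V}
    (he : e ∈ H) (hf : f ∈ H) (hg : g ∈ H) {c v : V} (hef : e ∩ f = {c}) (heg : e ∩ g = {v})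
    (hcv : c ≠ v) : g.erase v = f.erase c := by
  have k1 : ∀ t, t ∈ e ∧ t ∈ f ↔ t = c := by
    intro t; rw [← Finset.mem_inter, hef]; simp
  have k2 : ∀ t, t ∈ e ∧ t ∈ g ↔ t = v := by
    intro t; rw [← Finset.mem_inter, heg]; simp
  have hc := (k1 c).2 rfl
  have hv := (k2 v).2 rfl
  have hcg : c ∉ g := fun h => hcv ((k2 c).1 ⟨hc.1, h⟩)
  have hvf : v ∉ f := fun h => hcv ((k1 v).1 ⟨hv.1, h⟩).symm
  have s1 : g ∩ f ⊆ g.erase v := by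
    intro t ht
    rw [Finset.mem_inter] at ht
    rw [Finset.mem_erase]
    exact ⟨by rintro rfl; exact hvf ht.2, ht.1⟩
  have s2 : g ∩ f ⊆ f.erase c := by
    intro t ht
    rw [Finset.mem_inter] at ht
    rw [Finset.mem_erase]
    exact ⟨by rintro rfl; exact hcg ht.1, ht.2⟩
  have c1 : (g.erase v).card = 2 := by rw [Finset.card_erase_of_mem hv.2, hP.1 g hg]
  have c2 : (f.erase c).card = 2 := by rw [Finset.card_erase_of_mem hc.2, hP.1 f hf]
  have h0 : (g ∩ f).card ≠ 0 := by
    intro h0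
    rw [Finset.card_eq_zero] at h0
    exact hP.sets hg he hf (by rw [Finset.inter_comm, heg]; simp) (by rw [hef]; simp)
      (Finset.disjoint_iff_inter_eq_empty.2 h0)
  have h1 : (g ∩ f).card ≠ 1 := by
    intro h1
    obtain ⟨t, ht⟩ := Finset.card_eq_one.1 h1
    have ht' : t ∈ g ∩ f := by rw [ht]; simp
    have a1 := Finset.mem_erase.1 (s1 ht')
    have a2 := Finset.mem_erase.1 (s2 ht')
    exact hC.sets hP he hg hf c v t hcv a1.1.symm a2.1.symm heg ht hef
  have h2 : 2 ≤ (g ∩ f).card := by omega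
  rw [← Finset.eq_of_subset_of_card_le s1 (by omega), Finset.eq_of_subset_of_card_le s2 (by omega)]

theorem dirty_x {H : Finset (Finset V)} (hP : PF H) (hC : CF H) {e f : Finset V} {v : V}
    (he : e ∈ H) (hf : f ∈ H) (hve : v ∈ e) (hvf : v ∉ f) (hef : (e ∩ f).card = 1) :
    ∃ x, x ≠ v ∧ x ∈ e ∧ (H.filter (fun g => v ∈ g ∧ x ∉ g)).card ≤ 3 := by
  obtain ⟨c, hc⟩ := Finset.card_eq_one.1 hef
  have k1 : ∀ t, t ∈ e ∧ t ∈ f ↔ t = c := by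
    intro t; rw [← Finset.mem_inter, hc]; simp
  have hc1 := (k1 c).2 rfl
  have hcv : c ≠ v := by rintro rfl; exact hvf hc1.2
  obtain ⟨d, hdc, hdv, qe⟩ := split2 (hP.1 e he) hc1.1 hve hcv
  obtain ⟨g, h, hgh, hgc, hhc, qf⟩ := split1 (hP.1 f hf) hc1.2
  have hde : d ∈ e := by rw [qe]; simp
  have hdf : d ∉ f := fun h => hdc ((k1 d).1 ⟨hde, h⟩)
  have hfe : f.erase c = {g, h} := by rw [qf]; clear * - hgh hgc hhc; grind
  -- general claim
  have claim : ∀ y e', e' ∈ H → e' = {c, y, v} → y ∉ f → y ≠ v → ∀ g' ∈ H, v ∈ g' → c ∉ g' → y ∉ g' →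
      g' = {v, g, h} := by
    intro y e' he' q hyf hyv g' hg' hv hcg hyg
    have i1 : e' ∩ f = {c} := by
      ext t; rw [q]; simp only [Finset.mem_inter, Finset.mem_insert, Finset.mem_singleton]
      constructor
      · rintro ⟨rfl | rfl | rfl, h2⟩
        · rfl
        · exact absurd h2 hyf
        · exact absurd h2 hvf
      · rintro rfl; exact ⟨Or.inl rfl, hc1.2⟩
    have i2 : e' ∩ g' = {v} := by
      ext t; rw [q]; simp only [Finset.mem_inter, Finset.mem_insert, Finset.mem_singleton]
      constructor
      · rintro ⟨rfl | rfl | rfl, h2⟩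
        · exact absurd h2 hcg
        · exact absurd h2 hyg
        · rfl
      · rintro rfl; exact ⟨by simp, hv⟩
    have := key2 hP hC he' hf hg' i1 i2 hcv
    rw [← Finset.insert_erase hv, this, hfe]
  by_cases hi : ∃ y e', e' ∈ H ∧ e' = {c, y, v} ∧ y ∉ f ∧ y ≠ v ∧ y ≠ d
  · obtain ⟨y, e', he', q, hyf, hyv, hyd⟩ := hi
    refine ⟨c, hcv, hc1.1, ?_⟩
    refine le_trans (Finset.card_le_card (t := {{v, y, d}, {v, g, h}}) ?_)
      (Finset.card_le_two.trans (by omega))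
    intro g' hg'
    rw [Finset.mem_filter] at hg'
    obtain ⟨hg', hv, hcg⟩ := hg'
    simp only [Finset.mem_insert, Finset.mem_singleton]
    by_cases hd : d ∈ g'
    · by_cases hy : y ∈ g'
      · left
        obtain ⟨t, h1, h2, q'⟩ := split2 (hP.1 g' hg') hv hd hdv.symm
        have : y = t := by rw [q'] at hy; simp at hy; tauto
        rw [q', this]
      · have := claim y e' he' q hyf hyv g' hg' hv hcg hy
        exact Or.inr this
    · exact Or.inr (claim d e he qe hdf hdv g' hg' hv hcg hd)
  · refine ⟨d, hdv, hde, ?_⟩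
    refine le_trans (Finset.card_le_card (t := {{v, c, g}, {v, c, h}, {v, g, h}}) ?_)
      Finset.card_le_three
    intro g' hg'
    rw [Finset.mem_filter] at hg'
    obtain ⟨hg', hv, hd⟩ := hg'
    simp only [Finset.mem_insert, Finset.mem_singleton]
    by_cases hcg : c ∈ g'
    · obtain ⟨y, h1, h2, q'⟩ := split2 (hP.1 g' hg') hcg hv hcv
      have hyf : y ∈ f := by
        by_contra hyf
        exact hi ⟨y, g', hg', q', hyf, h2, by rintro rfl; exact hd (by rw [q']; simp)⟩
      have : y = g ∨ y = h := by rw [qf] at hyf; simp at hyf; tauto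
      rcases this with rfl | rfl
      · left; rw [q']; clear * -; grind
      · right; left; rw [q']; clear * -; grind
    · right; right; exact claim d e he qe hdf hdv g' hg' hv hcg hd
end LP

namespace LP
variable {V : Type} [DecidableEq V]

def deg (H : Finset (Finset V)) (v : V) : ℕ := (H.filter (v ∈ ·)).card

theorem dirty_bound {H : Finset (Finset V)} (hP : PF H) (hC : CF H) {U : Finset V}
    (hU : ∀ e ∈ H, e ⊆ U) (X : ℕ → ℕ) (hmono : Monotone X)
    (hX : ∀ U' ⊆ U, U'.card < U.card → ∀ H' ⊆ H, (∀ e ∈ H', e ⊆ U') → H'.card ≤ X U'.card)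
    {v : V} (hmax : ∀ u, deg H u ≤ deg H v) (hd9 : 9 ≤ deg H v)
    {e f : Finset V} (he : e ∈ H) (hf : f ∈ H) (hve : v ∈ e) (hvf : v ∉ f)
    (hef : (e ∩ f).card = 1) :
    ∃ k, deg H v ≤ k + 3 ∧ k + 2 ≤ U.card ∧
      (H.card ≤ k + U.card ∨ (k = deg H v ∧ k + 6 ≤ U.card) ∨ H.card ≤ k + 6 + X (U.card - k) ∨
        H.card ≤ k + 6 + (U.card - 4) + X (U.card - 2 - k)) := by
  obtain ⟨x, hxv, hxe, hO3⟩ := dirty_x hP hC he hf hve hvf hef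
  have hvU : v ∈ U := hU e he hve
  have hxU : x ∈ U := hU e he hxe
  set Ov := H.filter (fun g => v ∈ g ∧ x ∉ g) with hOv
  set Ox := H.filter (fun g => x ∈ g ∧ v ∉ g) with hOx
  set K := H.filter (fun g => v ∈ g ∧ x ∈ g) with hK
  set R0 := H.filter (fun g => v ∉ g ∧ x ∉ g) with hR0
  have dv : deg H v = K.card + Ov.card := by
    rw [deg, ← Finset.card_filter_add_card_filter_not (fun g => x ∈ g), Finset.filter_filter,
      Finset.filter_filter]
  have dx : deg H x = K.card + Ox.card := by
    rw [deg, ← Finset.card_filter_add_card_filter_not (fun g => v ∈ g), Finset.filter_filter,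
      Finset.filter_filter]
    simp only [hK, hOx, and_comm]
  have dH : H.card = deg H v + (Ox.card + R0.card) := by
    rw [← Finset.card_filter_add_card_filter_not (s := H) (fun g => v ∈ g)]
    congr 1
    rw [← Finset.card_filter_add_card_filter_not (s := H.filter (fun g => v ∉ g)) (fun g => x ∈ g),
      Finset.filter_filter, Finset.filter_filter]
    simp only [hOx, hR0, and_comm]
  have hOx3 : Ox.card ≤ Ov.card := by have := hmax x; omega
  set P := U.filter (fun p => p ≠ v ∧ p ≠ x ∧ {v, p, x} ∈ H) with hPdef
  have hKP : K.card ≤ P.card := by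
    have : K ⊆ P.image (fun p => {v, p, x}) := by
      intro g hg
      rw [hK, Finset.mem_filter] at hg
      obtain ⟨t, h1, h2, q⟩ := split2 (hP.1 g hg.1) hg.2.1 hg.2.2 hxv.symm
      rw [Finset.mem_image]
      refine ⟨t, ?_, q.symm⟩
      rw [hPdef, Finset.mem_filter]
      exact ⟨hU g hg.1 (by rw [q]; simp), h1, h2, q ▸ hg.1⟩
    exact (Finset.card_le_card this).trans Finset.card_image_le
  have hPp : ∀ p ∈ P, p ∈ U ∧ p ≠ v ∧ p ≠ x ∧ {v, p, x} ∈ H := by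
    intro p hp; rw [hPdef, Finset.mem_filter] at hp; exact hp
  set U2 := (U.erase v).erase x with hU2
  have hU2c : U2.card + 2 = U.card := by
    rw [hU2, Finset.card_erase_of_mem (Finset.mem_erase.2 ⟨hxv, hxU⟩), Finset.card_erase_of_mem hvU]
    have : 1 < U.card := Finset.one_lt_card.2 ⟨v, hvU, x, hxU, hxv.symm⟩
    omega
  have hPU2 : P ⊆ U2 := by
    intro p hp
    obtain ⟨h1, h2, h3, _⟩ := hPp p hp
    rw [hU2, Finset.mem_erase, Finset.mem_erase]; exact ⟨h3, h2, h1⟩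
  have hR0U2 : ∀ g ∈ R0, g ⊆ U2 := by
    intro g hg u hu
    rw [hR0, Finset.mem_filter] at hg
    rw [hU2, Finset.mem_erase, Finset.mem_erase]
    exact ⟨by rintro rfl; exact hg.2.2 hu, by rintro rfl; exact hg.2.1 hu, hU g hg.1 hu⟩
  have hR0H : ∀ g ∈ R0, g ∈ H ∧ v ∉ g ∧ x ∉ g := by
    intro g hg; rw [hR0, Finset.mem_filter] at hg; exact hg
  have hPc := Finset.card_le_card hPU2
  -- intersection of `vpx` with an edge avoiding `v, x`
  have hinter : ∀ p, ∀ g : Finset V, v ∉ g → x ∉ g → p ∈ g → ({v, p, x} : Finset V) ∩ g = {p} := by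
    intro p g h1 h2 h3
    ext t; simp only [Finset.mem_inter, Finset.mem_insert, Finset.mem_singleton]
    constructor
    · rintro ⟨rfl | rfl | rfl, h4⟩
      · exact absurd h4 h1
      · rfl
      · exact absurd h4 h2
    · rintro rfl; exact ⟨by simp, h3⟩
  have hdisj : ∀ p, ∀ g : Finset V, v ∉ g → x ∉ g → p ∉ g → Disjoint ({v, p, x} : Finset V) g := by
    intro p g h1 h2 h3
    rw [Finset.disjoint_left]
    intro t ht
    simp only [Finset.mem_insert, Finset.mem_singleton] at ht
    rcases ht with rfl | rfl | rfl <;> assumption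
  refine ⟨K.card, by omega, by omega, ?_⟩
  by_cases hpure : Ov.card = 0
  · -- pure case
    by_cases hs : ∃ e2 ∈ R0, ∃ e3 ∈ R0, (e2 ∩ e3).card = 1
    · right; left
      refine ⟨by omega, ?_⟩
      obtain ⟨e2, h2, e3, h3, h23⟩ := hs
      obtain ⟨q, hq⟩ := Finset.card_eq_one.1 h23
      have main : ∀ e2 ∈ R0, ∀ e3 ∈ R0, e2 ∩ e3 = {q} → Disjoint (e2.erase q) P := by
        intro e2 h2 e3 h3 hq
        rw [Finset.disjoint_left]
        intro p hp hpP
        obtain ⟨a1, a2, a3⟩ := hR0H e2 h2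
        obtain ⟨b1, b2, b3⟩ := hR0H e3 h3
        rw [Finset.mem_erase] at hp
        have : p ∉ e3 := by
          intro hp3
          have : p ∈ e2 ∩ e3 := Finset.mem_inter.2 ⟨hp.2, hp3⟩
          rw [hq] at this
          exact hp.1 (Finset.mem_singleton.1 this)
        exact hP.sets (hPp p hpP).2.2.2 a1 b1 (by rw [hinter p e2 a2 a3 hp.2]; simp) (by rw [hq]; simp)
          (hdisj p e3 b2 b3 this)
      have m2 := main e2 h2 e3 h3 hq
      have m3 := main e3 h3 e2 h2 (by rw [Finset.inter_comm]; exact hq)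
      have hq' : q ∈ e2 ∩ e3 := by rw [hq]; simp
      rw [Finset.mem_inter] at hq'
      have hd23 : Disjoint (e2.erase q) (e3.erase q) := by
        rw [Finset.disjoint_left]
        intro t ht1 ht2
        rw [Finset.mem_erase] at ht1 ht2
        have : t ∈ e2 ∩ e3 := Finset.mem_inter.2 ⟨ht1.2, ht2.2⟩
        rw [hq] at this
        exact ht1.1 (Finset.mem_singleton.1 this)
      have c2 : (e2.erase q).card = 2 := by
        rw [Finset.card_erase_of_mem hq'.1, hP.1 e2 (hR0H e2 h2).1]
      have c3 : (e3.erase q).card = 2 := by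
        rw [Finset.card_erase_of_mem hq'.2, hP.1 e3 (hR0H e3 h3).1]
      have hsub : (e2.erase q ∪ e3.erase q) ∪ P ⊆ U2 := by
        apply Finset.union_subset (Finset.union_subset ?_ ?_) hPU2
        · exact (Finset.erase_subset _ _).trans (hR0U2 e2 h2)
        · exact (Finset.erase_subset _ _).trans (hR0U2 e3 h3)
      have := Finset.card_le_card hsub
      rw [Finset.card_union_of_disjoint (Finset.disjoint_union_left.2 ⟨m2, m3⟩),
        Finset.card_union_of_disjoint hd23, c2, c3] at this
      omega
    · left
      push Not at hs
      have : R0.card ≤ U.card := by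
        apply oddtown U R0
        · intro g hg; exact hU g (hR0H g hg).1
        · intro g hg; exact hP.1 g (hR0H g hg).1
        · intro g hg g' hg' hne
          have h1 := hs g hg g' hg'
          have c1 := hP.1 g (hR0H g hg).1
          have c2 := hP.1 g' (hR0H g' hg').1
          have h2 : (g ∩ g').card ≠ 3 := by
            intro h3
            have i1 := Finset.eq_of_subset_of_card_le (Finset.inter_subset_left : g ∩ g' ⊆ g) (by omega)
            have i2 := Finset.eq_of_subset_of_card_le (Finset.inter_subset_right : g ∩ g' ⊆ g') (by omega)
            exact hne (i1.symm.trans i2)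
          have h3 : (g ∩ g').card ≤ 3 := by
            rw [← c1]; exact Finset.card_le_card Finset.inter_subset_left
          have : (g ∩ g').card = 0 ∨ (g ∩ g').card = 2 := by omega
          rcases this with h | h <;> rw [h] <;> decide
      omega
  · right; right
    obtain ⟨g0, hg0⟩ := Finset.card_pos.1 (Nat.pos_of_ne_zero hpure)
    rw [hOv, Finset.mem_filter] at hg0
    obtain ⟨hg0H, hvg0, hxg0⟩ := hg0
    set D := g0.erase v with hD
    have hDc : D.card = 2 := by rw [hD, Finset.card_erase_of_mem hvg0, hP.1 g0 hg0H]
    have hDU2 : D ⊆ U2 := by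
      intro t ht
      rw [hD, Finset.mem_erase] at ht
      rw [hU2, Finset.mem_erase, Finset.mem_erase]
      exact ⟨by rintro rfl; exact hxg0 ht.2, ht.1, hU g0 hg0H ht.2⟩
    have hvp0 : ∀ p ∉ D, ({v, p, x} : Finset V) ∩ g0 = {v} := by
      intro p hp
      ext t; simp only [Finset.mem_inter, Finset.mem_insert, Finset.mem_singleton]
      constructor
      · rintro ⟨rfl | rfl | rfl, h4⟩
        · rfl
        · by_contra hne
          exact hp (by rw [hD, Finset.mem_erase]; exact ⟨hne, h4⟩)
        · exact absurd h4 hxg0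
      · rintro rfl; exact ⟨by simp, hvg0⟩
    -- edges touching `P \ D` contain `D`
    have htouch : ∀ h ∈ R0, ∀ p ∈ P \ D, p ∈ h → D ⊆ h ∧ h = insert p D := by
      intro h hh p hp hph
      rw [Finset.mem_sdiff] at hp
      obtain ⟨a1, a2, a3⟩ := hR0H h hh
      obtain ⟨b1, b2, b3, b4⟩ := hPp p hp.1
      have := key2 hP hC b4 hg0H a1 (hvp0 p hp.2) (hinter p h a2 a3 hph) b2.symm
      constructor
      · rw [hD, ← this]; exact Finset.erase_subset _ _
      · rw [hD, ← this, Finset.insert_erase hph]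
    set R := U2 \ (P \ D) with hR
    have hPD : P.card ≤ (P \ D).card + 2 := by
      have := Finset.le_card_sdiff D P; omega
    have hRc : R.card + (P \ D).card = U2.card :=
      Finset.card_sdiff_add_card_eq_card (Finset.sdiff_subset.trans hPU2)
    have hRU : R ⊆ U := by
      intro t ht
      rw [hR, Finset.mem_sdiff, hU2, Finset.mem_erase, Finset.mem_erase] at ht
      exact ht.1.2.2
    have hin : ∀ g ∈ R0, (∀ p ∈ P \ D, p ∉ g) → g ⊆ R := by
      intro g hg hh t ht
      rw [hR, Finset.mem_sdiff]
      exact ⟨hR0U2 g hg ht, fun h => hh t h ht⟩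
    by_cases hh : ∃ h ∈ R0, ∃ p ∈ P \ D, p ∈ h
    · right
      obtain ⟨h, hhR, p, hp, hph⟩ := hh
      obtain ⟨hDh, hheq⟩ := htouch h hhR p hp hph
      obtain ⟨a1, a2, a3⟩ := hR0H h hhR
      have hpP := (Finset.mem_sdiff.1 hp).1
      have hpD := (Finset.mem_sdiff.1 hp).2
      have hcover : R0 ⊆ (U2 \ D).image (fun p => insert p D) ∪ H.filter (· ⊆ R \ D) := by
        intro g hg
        obtain ⟨b1, b2, b3⟩ := hR0H g hg
        rw [Finset.mem_union]
        by_cases hDg : D ⊆ g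
        · left
          have hcd : (g \ D).card = 1 := by
            rw [Finset.card_sdiff_of_subset hDg, hDc, hP.1 g b1]
          obtain ⟨t, ht⟩ := Finset.card_eq_one.1 hcd
          have ht' : t ∈ g \ D := by rw [ht]; simp
          rw [Finset.mem_sdiff] at ht'
          rw [Finset.mem_image]
          refine ⟨t, Finset.mem_sdiff.2 ⟨hR0U2 g hg ht'.1, ht'.2⟩, ?_⟩
          rw [← Finset.sdiff_union_of_subset hDg, ht]; rfl
        · right
          have hno : ∀ p ∈ P \ D, p ∉ g := by
            intro p' hp' hpg
            exact hDg (htouch g hg p' hp' hpg).1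
          have hgR := hin g hg hno
          rw [Finset.mem_filter]
          refine ⟨b1, ?_⟩
          intro t ht
          rw [Finset.mem_sdiff]
          refine ⟨hgR ht, fun htD => ?_⟩
          have hhg : h ∩ g = D ∩ g := by
            rw [hheq, Finset.insert_inter_of_notMem (hno p hp)]
          have h1 : (D ∩ g).card ≤ 1 := by
            by_contra hlt
            have : D ∩ g = D := Finset.eq_of_subset_of_card_le Finset.inter_subset_left (by omega)
            exact hDg (Finset.inter_eq_left.1 this)
          have h2 : 0 < (D ∩ g).card := Finset.card_pos.2 ⟨t, Finset.mem_inter.2 ⟨htD, ht⟩⟩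
          exact hP.sets (hPp p hpP).2.2.2 a1 b1 (by rw [hinter p h a2 a3 hph]; simp)
            (by rw [hhg]; omega) (hdisj p g b2 b3 (hno p hp))
      have c1 := (Finset.card_le_card hcover).trans (Finset.card_union_le _ _)
      have c2 : ((U2 \ D).image (fun p => insert p D)).card ≤ (U2 \ D).card := Finset.card_image_le
      have c3 : (U2 \ D).card + D.card = U2.card := Finset.card_sdiff_add_card_eq_card hDU2
      have hRD : (R \ D) ⊆ U2 \ P := by
        intro t ht
        rw [Finset.mem_sdiff, hR, Finset.mem_sdiff, Finset.mem_sdiff] at ht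
        rw [Finset.mem_sdiff]
        exact ⟨ht.1.1, fun h => ht.1.2 ⟨h, ht.2⟩⟩
      have c4 := Finset.card_le_card hRD
      have c5 : (U2 \ P).card + P.card = U2.card := Finset.card_sdiff_add_card_eq_card hPU2
      have c6 : (H.filter (· ⊆ R \ D)).card ≤ X (R \ D).card := by
        apply hX _ (Finset.sdiff_subset.trans hRU) (by omega) _ (Finset.filter_subset _ _)
        intro g hg; exact (Finset.mem_filter.1 hg).2
      have c7 : X (R \ D).card ≤ X (U.card - 2 - K.card) := hmono (by omega)
      omega
    · left
      push Not at hh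
      have c6 : R0.card ≤ X R.card := by
        apply hX _ hRU (by omega) _ (Finset.filter_subset _ _)
        intro g hg; exact hin g hg (hh g hg)
      have c7 : X R.card ≤ X (U.card - K.card) := hmono (by omega)
      omega
end LP

namespace LP
variable {V : Type} [DecidableEq V]

theorem dcount (s : Finset V) (t : Finset (Finset V)) :
    ∑ a ∈ s, (t.filter (a ∈ ·)).card = ∑ e ∈ t, (e ∩ s).card := by
  have h1 : ∀ a ∈ s, (t.filter (a ∈ ·)).card = ∑ e ∈ t, if a ∈ e then 1 else 0 := by
    intro a _; rw [Finset.card_filter]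
  have h2 : ∀ e ∈ t, (e ∩ s).card = ∑ a ∈ s, if a ∈ e then 1 else 0 := by
    intro e _; rw [← Finset.card_filter, Finset.inter_comm, Finset.filter_mem_eq_inter]
  rw [Finset.sum_congr rfl h1, Finset.sum_congr rfl h2, Finset.sum_comm]

theorem cf_six {H : Finset (Finset V)} (hP : PF H) (hC : CF H) {U : Finset V}
    (hU : ∀ e ∈ H, e ⊆ U) (h6 : U.card = 6) : H.card ≤ 19 := by
  have hsub : H ⊆ Finset.powersetCard 3 U := by
    intro e he; rw [Finset.mem_powersetCard]; exact ⟨hU e he, hP.1 e he⟩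
  have hc : (Finset.powersetCard 3 U).card = 20 := by
    rw [Finset.card_powersetCard, h6]; rfl
  by_contra hlt
  have heq := Finset.eq_of_subset_of_card_le hsub (by omega)
  have hl : U.toList.length = 6 := by rw [Finset.length_toList, h6]
  have hnd := Finset.nodup_toList U
  have hm : ∀ a, a ∈ U.toList ↔ a ∈ U := fun a => Finset.mem_toList
  match hL : U.toList, hl with
  | [x, y, z, a, b, c], _ =>
    rw [hL] at hnd
    simp only [hL] at hm
    have mem : ∀ p q r, p ∈ [x, y, z, a, b, c] → q ∈ [x, y, z, a, b, c] → r ∈ [x, y, z, a, b, c] →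
        p ≠ q → p ≠ r → q ≠ r → {p, q, r} ∈ H := by
      intro p q r hp hq hr h1 h2 h3
      rw [heq, Finset.mem_powersetCard]
      refine ⟨?_, Finset.card_eq_three.2 ⟨p, q, r, h1, h2, h3, rfl⟩⟩
      intro t ht
      rw [← hm]
      simp only [Finset.mem_insert, Finset.mem_singleton] at ht
      rcases ht with rfl | rfl | rfl <;> assumption
    have hnd' := hnd
    simp only [List.nodup_cons, List.mem_cons, not_or, List.not_mem_nil] at hnd'
    obtain ⟨⟨k1, k2, k3, k4, k5, _⟩, ⟨l1, l2, l3, l4, _⟩, ⟨m1, m2, m3, _⟩, ⟨n1, n2, _⟩, ⟨o1, _⟩, _⟩ := hnd'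
    refine hC x y z a b c hnd (mem _ _ _ ?_ ?_ ?_ ?_ ?_ ?_) (mem _ _ _ ?_ ?_ ?_ ?_ ?_ ?_)
      (mem _ _ _ ?_ ?_ ?_ ?_ ?_ ?_) <;> first | assumption | (apply Ne.symm; assumption) | (simp; done)

theorem clean_bound {H : Finset (Finset V)} (hP : PF H) (hC : CF H) {U : Finset V}
    (hU : ∀ e ∈ H, e ⊆ U) (X : ℕ → ℕ)
    (hX : ∀ U' ⊆ U, U'.card < U.card → ∀ H' ⊆ H, (∀ e ∈ H', e ⊆ U') → H'.card ≤ X U'.card)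
    {v : V} (hvU : v ∈ U)
    (hclean : ∀ e ∈ H, ∀ f ∈ H, v ∈ e → v ∉ f → (e ∩ f).card ≠ 1) :
    ∃ w A, A ≤ w ∧ w + 1 ≤ U.card ∧ (H.filter (v ∉ ·)).card ≤ w.choose 3 ∧
      deg H v ≤ (U.card - 1 - w).choose 2 + A ∧
      H.card ≤ (U.card - 1 - w).choose 2 + A + A / 3 + (A / 2) * (w - A) +
        (if w - A = 6 then 19 else X (w - A)) := by
  set F := H.filter (v ∉ ·) with hF
  set L := H.filter (v ∈ ·) with hL
  have hFp : ∀ f ∈ F, f ∈ H ∧ v ∉ f := by intro f hf; rw [hF, Finset.mem_filter] at hf; exact hf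
  have hLp : ∀ f ∈ L, f ∈ H ∧ v ∈ f := by intro f hf; rw [hL, Finset.mem_filter] at hf; exact hf
  have hHc : H.card = L.card + F.card := by
    rw [hL, hF, Finset.card_filter_add_card_filter_not]
  set W := F.biUnion id with hW
  have hWU : W ⊆ U.erase v := by
    intro t ht
    rw [hW, Finset.mem_biUnion] at ht
    obtain ⟨f, hf, htf⟩ := ht
    obtain ⟨f1, f2⟩ := hFp f hf
    rw [Finset.mem_erase]
    exact ⟨by rintro rfl; exact f2 htf, hU f f1 htf⟩
  have hFW : ∀ f ∈ F, f ⊆ W := by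
    intro f hf t ht; rw [hW, Finset.mem_biUnion]; exact ⟨f, hf, ht⟩
  have hLc : ∀ e ∈ L, (e.erase v).card = 2 := by
    intro e he; rw [Finset.card_erase_of_mem (hLp e he).2, hP.1 e (hLp e he).1]
  have star : ∀ e ∈ L, ∀ f ∈ F, ∀ t ∈ e, t ∈ f → e.erase v ⊆ f := by
    intro e he f hf t hte htf
    obtain ⟨e1, e2⟩ := hLp e he
    obtain ⟨f1, f2⟩ := hFp f hf
    have h1 := hclean e e1 f f1 e2 f2
    have h2 : 0 < (e ∩ f).card := Finset.card_pos.2 ⟨t, Finset.mem_inter.2 ⟨hte, htf⟩⟩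
    have h3 : e ∩ f ⊆ e.erase v := by
      intro s hs
      rw [Finset.mem_inter] at hs
      rw [Finset.mem_erase]
      exact ⟨by rintro rfl; exact f2 hs.2, hs.1⟩
    have h4 := Finset.eq_of_subset_of_card_le h3 (by rw [hLc e he]; omega)
    rw [← h4]; exact Finset.inter_subset_right
  set L1 := L.filter (fun e => e.erase v ⊆ W) with hL1
  set L0 := L.filter (fun e => ¬ e.erase v ⊆ W) with hL0
  have hLsum : L.card = L1.card + L0.card := by
    rw [hL1, hL0, Finset.card_filter_add_card_filter_not]
  have hL1p : ∀ e ∈ L1, e ∈ L ∧ e.erase v ⊆ W := by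
    intro e he; rw [hL1, Finset.mem_filter] at he; exact he
  have hUv : (U.erase v).card = U.card - 1 := Finset.card_erase_of_mem hvU
  have hUpos : 0 < U.card := Finset.card_pos.2 ⟨v, hvU⟩
  have hWc : (U.erase v \ W).card + W.card = (U.erase v).card :=
    Finset.card_sdiff_add_card_eq_card hWU
  have injE : ∀ S : Finset (Finset V), S ⊆ L → Set.InjOn (fun e : Finset V => e.erase v) S := by
    intro S hS e he f hf hef
    have h1 := (hLp e (hS he)).2
    have h2 := (hLp f (hS hf)).2
    simp only at hef
    rw [← Finset.insert_erase h1, hef, Finset.insert_erase h2]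
  have hL0c : L0.card ≤ (U.card - 1 - W.card).choose 2 := by
    have h1 : L0.image (fun e => e.erase v) ⊆ Finset.powersetCard 2 (U.erase v \ W) := by
      intro g hg
      obtain ⟨e, he, rfl⟩ := Finset.mem_image.1 hg
      rw [hL0, Finset.mem_filter] at he
      rw [Finset.mem_powersetCard]
      refine ⟨?_, hLc e he.1⟩
      intro t ht
      rw [Finset.mem_sdiff]
      refine ⟨Finset.erase_subset_erase _ (hU e (hLp e he.1).1) ht, fun htW => ?_⟩
      rw [hW, Finset.mem_biUnion] at htW
      obtain ⟨f, hf, htf⟩ := htW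
      exact he.2 ((star e he.1 f hf t (Finset.mem_of_mem_erase ht) htf).trans (hFW f hf))
    have h2 := Finset.card_le_card h1
    rw [Finset.card_image_of_injOn (injE L0 (Finset.filter_subset _ _)), Finset.card_powersetCard] at h2
    rwa [show (U.erase v \ W).card = U.card - 1 - W.card by omega] at h2
  set A := L1.biUnion (fun e => e.erase v) with hA
  have hAW : A ⊆ W := by
    intro t ht
    rw [hA, Finset.mem_biUnion] at ht
    obtain ⟨e, he, hte⟩ := ht
    exact (hL1p e he).2 hte
  have hL1c : L1.card ≤ A.card := by
    have h1 : ∑ t ∈ A, (L1.filter (t ∈ ·)).card ≤ ∑ t ∈ A, 2 := by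
      apply Finset.sum_le_sum
      intro t ht
      have htW := hAW ht
      have htv : t ≠ v := (Finset.mem_erase.1 (hWU htW)).1
      rw [hW, Finset.mem_biUnion] at htW
      obtain ⟨f, hf, htf⟩ := htW
      change t ∈ f at htf
      have hsub : L1.filter (t ∈ ·) ⊆ (f.erase t).image (fun s => {v, s, t}) := by
        intro e he
        rw [Finset.mem_filter] at he
        have heL := (hL1p e he.1).1
        have h2 := star e heL f hf t he.2 htf
        obtain ⟨s, hs1, hs2, q⟩ := split2 (hP.1 e (hLp e heL).1) (hLp e heL).2 he.2 htv.symm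
        rw [Finset.mem_image]
        refine ⟨s, ?_, q.symm⟩
        rw [Finset.mem_erase]
        exact ⟨hs2, h2 (by rw [Finset.mem_erase, q]; exact ⟨hs1, by simp⟩)⟩
      refine (Finset.card_le_card hsub).trans (Finset.card_image_le.trans ?_)
      rw [Finset.card_erase_of_mem htf, hP.1 f (hFp f hf).1]
    rw [dcount] at h1
    have h2 : ∑ e ∈ L1, 2 ≤ ∑ e ∈ L1, (e ∩ A).card := by
      apply Finset.sum_le_sum
      intro e he
      rw [← hLc e (hL1p e he).1]
      apply Finset.card_le_card
      intro t ht
      rw [Finset.mem_inter]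
      refine ⟨Finset.mem_of_mem_erase ht, ?_⟩
      rw [hA, Finset.mem_biUnion]; exact ⟨e, he, ht⟩
    simp only [Finset.sum_const, smul_eq_mul] at h1 h2
    omega
  have hAp : ∀ t ∈ A, ∃ e ∈ L1, t ∈ e.erase v ∧ e.erase v ⊆ A := by
    intro t ht
    have ht' := ht
    rw [hA, Finset.mem_biUnion] at ht'
    obtain ⟨e, he, hte⟩ := ht'
    refine ⟨e, he, hte, ?_⟩
    intro s hs
    rw [hA, Finset.mem_biUnion]; exact ⟨e, he, hs⟩
  set F3 := F.filter (fun f => f ⊆ A) with hF3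
  set F0 := F.filter (fun f => Disjoint f A) with hF0
  set F2 := F.filter (fun f => ¬ f ⊆ A ∧ ¬ Disjoint f A) with hF2
  have hFcov : F ⊆ F3 ∪ (F0 ∪ F2) := by
    intro f hf
    simp only [Finset.mem_union, hF3, hF0, hF2, Finset.mem_filter]
    tauto
  have hFcard : F.card ≤ F3.card + (F0.card + F2.card) :=
    (Finset.card_le_card hFcov).trans ((Finset.card_union_le _ _).trans
      (Nat.add_le_add_left (Finset.card_union_le _ _) _))
  have eqF : ∀ f ∈ F, ∀ g ∈ F, f ⊆ g → f = g := by
    intro f hf g hg h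
    exact Finset.eq_of_subset_of_card_le h
      (by rw [hP.1 f (hFp f hf).1, hP.1 g (hFp g hg).1])
  have hF3c : F3.card ≤ A.card / 3 := by
    have hdis : ∀ f ∈ F3, ∀ g ∈ F3, f ≠ g → Disjoint (id f) (id g) := by
      intro f hf g hg hfg
      rw [hF3, Finset.mem_filter] at hf hg
      by_contra hnd
      rw [Finset.not_disjoint_iff] at hnd
      obtain ⟨t, htf, htg⟩ := hnd
      simp only [id] at htf htg
      apply hfg
      apply eqF f hf.1 g hg.1
      intro r hr
      by_contra hrg
      obtain ⟨e1, he1, hte1, _⟩ := hAp t (hf.2 htf)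
      obtain ⟨e2, he2, hre2, _⟩ := hAp r (hf.2 hr)
      have s1 := star e1 (hL1p e1 he1).1 f hf.1 t (Finset.mem_of_mem_erase hte1) htf
      have s2 := star e1 (hL1p e1 he1).1 g hg.1 t (Finset.mem_of_mem_erase hte1) htg
      have s3 := star e2 (hL1p e2 he2).1 f hf.1 r (Finset.mem_of_mem_erase hre2) hr
      have hd : Disjoint (e1.erase v) (e2.erase v) := by
        rw [Finset.disjoint_left]
        intro s hs1 hs2
        exact hrg (star e2 (hL1p e2 he2).1 g hg.1 s (Finset.mem_of_mem_erase hs2) (s2 hs1) hre2)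
      have := Finset.card_le_card (Finset.union_subset s1 s3)
      rw [Finset.card_union_of_disjoint hd, hLc e1 (hL1p e1 he1).1, hLc e2 (hL1p e2 he2).1,
        hP.1 f (hFp f hf.1).1] at this
      omega
    have h1 := Finset.card_biUnion hdis
    have h2 : F3.biUnion id ⊆ A := by
      intro t ht
      rw [Finset.mem_biUnion] at ht
      obtain ⟨f, hf, htf⟩ := ht
      rw [hF3, Finset.mem_filter] at hf
      exact hf.2 htf
    have h3 := Finset.card_le_card h2
    rw [h1, Finset.sum_congr rfl (g := fun _ => 3)] at h3
    · rw [Finset.sum_const, smul_eq_mul] at h3; omega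
    · intro f hf
      rw [hF3, Finset.mem_filter] at hf
      exact hP.1 f (hFp f hf.1).1
  have hF2c : F2.card ≤ A.card / 2 * (W.card - A.card) := by
    have hcov : F2 ⊆ (W \ A).biUnion (fun z => F2.filter (z ∈ ·)) := by
      intro f hf
      have hf' := hf
      rw [hF2, Finset.mem_filter, Finset.not_subset] at hf'
      obtain ⟨hfF, ⟨z, hz1, hz2⟩, _⟩ := hf'
      rw [Finset.mem_biUnion]
      exact ⟨z, Finset.mem_sdiff.2 ⟨hFW f hfF hz1, hz2⟩, Finset.mem_filter.2 ⟨hf, hz1⟩⟩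
    have h1 := (Finset.card_le_card hcov).trans Finset.card_biUnion_le
    have h2 : ∑ z ∈ W \ A, (F2.filter (z ∈ ·)).card ≤ ∑ z ∈ W \ A, A.card / 2 := by
      apply Finset.sum_le_sum
      intro z hz
      have hzA := (Finset.mem_sdiff.1 hz).2
      have pr : ∀ f ∈ F2.filter (z ∈ ·), f ∈ F ∧ z ∈ f ∧ ∃ e ∈ L1, f.erase z = e.erase v ∧ e.erase v ⊆ A := by
        intro f hf
        rw [Finset.mem_filter, hF2, Finset.mem_filter, Finset.not_disjoint_iff] at hf
        obtain ⟨⟨hfF, _, t, htf, htA⟩, hzf⟩ := hf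
        refine ⟨hfF, hzf, ?_⟩
        obtain ⟨e, he, hte, heA⟩ := hAp t htA
        refine ⟨e, he, ?_, heA⟩
        have s1 := star e (hL1p e he).1 f hfF t (Finset.mem_of_mem_erase hte) htf
        symm
        apply Finset.eq_of_subset_of_card_le
        · intro s hs
          rw [Finset.mem_erase]
          exact ⟨by rintro rfl; exact hzA (heA hs), s1 hs⟩
        · rw [hLc e (hL1p e he).1, Finset.card_erase_of_mem hzf, hP.1 f (hFp f hfF).1]
      have hdis : ∀ f ∈ F2.filter (z ∈ ·), ∀ g ∈ F2.filter (z ∈ ·), f ≠ g →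
          Disjoint (f.erase z) (g.erase z) := by
        intro f hf g hg hfg
        obtain ⟨f1, f2, e, he, q, _⟩ := pr f hf
        obtain ⟨g1, g2, _⟩ := pr g hg
        rw [Finset.disjoint_left]
        intro t ht1 ht2
        apply hfg
        apply eqF f f1 g g1
        rw [q] at ht1
        have s1 := star e (hL1p e he).1 g g1 t (Finset.mem_of_mem_erase ht1) (Finset.mem_of_mem_erase ht2)
        rw [← q] at s1
        rw [← Finset.insert_erase f2]
        exact Finset.insert_subset g2 s1
      have h1 := Finset.card_biUnion hdis
      have h2 : (F2.filter (z ∈ ·)).biUnion (fun f => f.erase z) ⊆ A := by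
        intro t ht
        rw [Finset.mem_biUnion] at ht
        obtain ⟨f, hf, htf⟩ := ht
        obtain ⟨f1, f2, e, he, q, hA'⟩ := pr f hf
        rw [q] at htf
        exact hA' htf
      have h3 := Finset.card_le_card h2
      rw [h1, Finset.sum_congr rfl (g := fun _ => 2)] at h3
      · rw [Finset.sum_const, smul_eq_mul] at h3; omega
      · intro f hf
        obtain ⟨f1, f2, _⟩ := pr f hf
        rw [Finset.card_erase_of_mem f2, hP.1 f (hFp f f1).1]
    rw [Finset.sum_const, smul_eq_mul, Finset.card_sdiff_of_subset hAW, mul_comm] at h2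
    omega
  have hWAc : (W \ A).card = W.card - A.card := Finset.card_sdiff_of_subset hAW
  have hF0p : ∀ e ∈ F0, e ⊆ W \ A := by
    intro f hf t ht
    rw [hF0, Finset.mem_filter] at hf
    rw [Finset.mem_sdiff]
    exact ⟨hFW f hf.1 ht, Finset.disjoint_left.1 hf.2 ht⟩
  have hF0H : F0 ⊆ H := (Finset.filter_subset _ _).trans (Finset.filter_subset _ _)
  have hF0c : F0.card ≤ if W.card - A.card = 6 then 19 else X (W.card - A.card) := by
    split_ifs with h6
    · refine cf_six (U := W \ A) ⟨fun e he => hP.1 e (hF0H he), ?_⟩ ?_ hF0p (by omega)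
      · intro a b c d e f g hn h1 h2 h3
        exact hP.2 a b c d e f g hn (hF0H h1) (hF0H h2) (hF0H h3)
      · intro x y z a b c hn h1 h2 h3
        exact hC x y z a b c hn (hF0H h1) (hF0H h2) (hF0H h3)
    · rw [← hWAc]
      apply hX _ (Finset.sdiff_subset.trans (hWU.trans (Finset.erase_subset _ _))) ?_ _ hF0H hF0p
      have := Finset.card_le_card (Finset.sdiff_subset : W \ A ⊆ W)
      omega
  refine ⟨W.card, A.card, Finset.card_le_card hAW, by omega, ?_, ?_, ?_⟩
  · rw [← Finset.card_powersetCard]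
    apply Finset.card_le_card
    intro f hf
    rw [Finset.mem_powersetCard]
    exact ⟨hFW f hf, hP.1 f (hFp f hf).1⟩
  · change L.card ≤ _
    omega
  · omega
end LP

namespace LP
variable {V : Type} [DecidableEq V]

def X (m : ℕ) : ℕ :=
  if m = 7 then 20 else if m = 8 then 24 else if m = 9 then 28 else if m = 10 then 36 else m.choose 3

theorem X_mono : Monotone X := by
  apply monotone_nat_of_le_succ
  intro n
  by_cases h : n ≤ 10
  · interval_cases n <;> decide
  · rw [X, X]
    simp only [show n ≠ 7 by omega, show n ≠ 8 by omega, show n ≠ 9 by omega, show n ≠ 10 by omega,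
      show n + 1 ≠ 7 by omega, show n + 1 ≠ 8 by omega, show n + 1 ≠ 9 by omega,
      show n + 1 ≠ 10 by omega, if_false]
    exact Nat.choose_le_choose _ (by omega)

/-- purely numerical side conditions -/
def Ok (n B d0 w0 : ℕ) : Prop :=
  9 ≤ d0 ∧ n * (d0 - 1) < 3 * (B + 1) ∧
  (∀ u < n + 1, 7 ≤ u → 3 * u + X (n - u) ≤ B + 4) ∧
  (∀ k < n - 1, d0 ≤ k + 3 → k + n ≤ B ∧ ¬ (d0 ≤ k ∧ k + 6 ≤ n) ∧ k + 6 + X (n - k) ≤ B ∧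
    k + 6 + (n - 4) + X (n - 2 - k) ≤ B) ∧
  (∀ w < n, ∀ A < w + 1, w0 ≤ w → d0 ≤ (n - 1 - w).choose 2 + A →
    (n - 1 - w).choose 2 + A + A / 3 + (A / 2) * (w - A) +
        (if w - A = 6 then 19 else X (w - A)) ≤ B)

instance (n B d0 w0 : ℕ) : Decidable (Ok n B d0 w0) := by unfold Ok; infer_instance

theorem PF.mono {H H' : Finset (Finset V)} (hP : PF H) (h : H' ⊆ H) : PF H' :=
  ⟨fun e he => hP.1 e (h he), fun a b c d e f g hn h1 h2 h3 =>
    hP.2 a b c d e f g hn (h h1) (h h2) (h h3)⟩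

theorem CF_or (H : Finset (Finset V)) : CF H ∨ ∃ x y z a b c, CC H x y z a b c := by
  by_cases h : CF H
  · exact Or.inl h
  · right
    unfold CF at h
    push Not at h
    obtain ⟨x, y, z, a, b, c, hn, h1, h2, h3, _⟩ := h
    exact ⟨x, y, z, a, b, c, hn, h1, h2, h3⟩

theorem deg_sum {H : Finset (Finset V)} (h3 : ∀ e ∈ H, e.card = 3) {U : Finset V}
    (hU : ∀ e ∈ H, e ⊆ U) : ∑ v ∈ U, deg H v = 3 * H.card := by
  unfold deg
  rw [dcount, Finset.sum_congr rfl (g := fun _ => 3)]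
  · rw [Finset.sum_const, smul_eq_mul, mul_comm]
  · intro e he
    rw [Finset.inter_eq_left.2 (hU e he), h3 e he]

theorem step {H : Finset (Finset V)} (hP : PF H) {U : Finset V} (hU : ∀ e ∈ H, e ⊆ U)
    (hX : ∀ U' ⊆ U, U'.card < U.card → ∀ H' ⊆ H, (∀ e ∈ H', e ⊆ U') → H'.card ≤ X U'.card)
    {n B d0 w0 : ℕ} (hn : U.card = n) (ok : Ok n B d0 w0) :
    H.card ≤ B ∨ (∃ S ⊆ U, S.card = 6 ∧ ∀ e ∈ H, e ⊆ S ∨ Disjoint e S) ∨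
      ∃ v ∈ U, ∃ w < w0, (H.filter (v ∉ ·)).card ≤ w.choose 3 := by
  obtain ⟨o1, o2, o3, o4, o5⟩ := ok
  by_cases hB : H.card ≤ B
  · exact Or.inl hB
  right
  push Not at hB
  rcases CF_or H with hC | ⟨x, y, z, a, b, c, h⟩
  · right
    have hne : U.Nonempty := by
      obtain ⟨e, he⟩ : H.Nonempty := Finset.card_pos.1 (by omega)
      obtain ⟨t, ht⟩ : e.Nonempty := Finset.card_pos.1 (by rw [hP.1 e he]; omega)
      exact ⟨t, hU e he ht⟩
    obtain ⟨v, hv, hvm⟩ := Finset.exists_max_image U (deg H) hne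
    have hs := deg_sum hP.1 hU
    have hd : d0 ≤ deg H v := by
      by_contra hlt
      have : ∑ u ∈ U, deg H u ≤ ∑ u ∈ U, (d0 - 1) :=
        Finset.sum_le_sum (fun u hu => (hvm u hu).trans (by omega))
      rw [hs, Finset.sum_const, smul_eq_mul, hn] at this
      omega
    have hmax : ∀ u, deg H u ≤ deg H v := by
      intro u
      by_cases hu : u ∈ U
      · exact hvm u hu
      · have : deg H u = 0 := by
          unfold deg
          rw [Finset.card_eq_zero, Finset.filter_eq_empty_iff]
          intro e he hue
          exact hu (hU e he hue)
        omega
    by_cases hcl : ∀ e ∈ H, ∀ f ∈ H, v ∈ e → v ∉ f → (e ∩ f).card ≠ 1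
    · obtain ⟨w, A, h1, h2, h3, h4, h5⟩ := clean_bound hP hC hU X hX hv hcl
      rw [hn] at h2 h4 h5
      refine ⟨v, hv, w, ?_, h3⟩
      by_contra hw
      have := o5 w (by omega) A (by omega) (by omega) (hd.trans h4)
      omega
    · exfalso
      push Not at hcl
      obtain ⟨e, he, f, hf, hve, hvf, hef⟩ := hcl
      obtain ⟨k, h1, h2, h3⟩ := dirty_bound hP hC hU X X_mono hX hmax (by omega) he hf hve hvf hef
      rw [hn] at h2 h3
      obtain ⟨p1, p2, p3, p4⟩ := o4 k (by omega) (by omega)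
      rcases h3 with h | h | h | h
      · omega
      · exact p2 ⟨by omega, h.2⟩
      · omega
      · omega
  · rcases caseC hP hU X hX h with h | ⟨u, h1, h2, h3⟩
    · exact Or.inl h
    · rw [hn] at h2 h3
      have := o3 u (by omega) h1
      omega

theorem split_bound {H : Finset (Finset V)} {U S : Finset V} (h3 : ∀ e ∈ H, e.card = 3)
    (hU : ∀ e ∈ H, e ⊆ U)
    (hS : ∀ e ∈ H, e ⊆ S ∨ Disjoint e S) :
    H.card = (H.filter (· ⊆ S)).card + (H.filter (· ⊆ U \ S)).card := by
  rw [← Finset.card_filter_add_card_filter_not (s := H) (· ⊆ S)]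
  congr 2
  ext e
  simp only [Finset.mem_filter]
  constructor
  · rintro ⟨h1, h2⟩
    refine ⟨h1, Finset.subset_sdiff.2 ⟨hU e h1, (hS e h1).resolve_left h2⟩⟩
  · rintro ⟨h1, h2⟩
    refine ⟨h1, fun h => ?_⟩
    have h4 := (Finset.subset_sdiff.1 h2).2
    have : e = ∅ := by
      rw [← Finset.disjoint_self_iff_empty]
      exact h4.mono_right h
    have h5 := h3 e h1
    rw [this] at h5
    simp at h5

theorem triv_bound {H : Finset (Finset V)} {U : Finset V} (h3 : ∀ e ∈ H, e.card = 3)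
    (hU : ∀ e ∈ H, e ⊆ U) : H.card ≤ U.card.choose 3 := by
  rw [← Finset.card_powersetCard]
  apply Finset.card_le_card
  intro f hf
  rw [Finset.mem_powersetCard]
  exact ⟨hU f hf, h3 f hf⟩

theorem deg_bound {H : Finset (Finset V)} {U : Finset V} (h3 : ∀ e ∈ H, e.card = 3)
    (hU : ∀ e ∈ H, e ⊆ U) {v : V} (hv : v ∈ U) : deg H v ≤ (U.card - 1).choose 2 := by
  rw [← Finset.card_erase_of_mem hv, ← Finset.card_powersetCard, deg]
  apply Finset.card_le_card_of_injOn (fun e => e.erase v)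
  · intro e he
    simp only [Finset.coe_filter, Set.mem_ofPred_eq] at he
    simp only [Finset.mem_coe, Finset.mem_powersetCard]
    exact ⟨Finset.erase_subset_erase _ (hU e he.1), by rw [Finset.card_erase_of_mem he.2, h3 e he.1]⟩
  · intro e he f hf hef
    simp only [Finset.coe_filter, Set.mem_ofPred_eq] at he hf
    simp only at hef
    rw [← Finset.insert_erase he.2, hef, Finset.insert_erase hf.2]

theorem deg_add (H : Finset (Finset V)) (v : V) : H.card = deg H v + (H.filter (v ∉ ·)).card := by
  rw [deg, Finset.card_filter_add_card_filter_not]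

theorem Xb : ∀ n : ℕ, ∀ (H : Finset (Finset V)) (U : Finset V), PF H → (∀ e ∈ H, e ⊆ U) →
    U.card = n → H.card ≤ X n := by
  intro n
  induction n using Nat.strong_induction_on with
  | _ n ih =>
  intro H U hP hU hn
  have hX : ∀ U' ⊆ U, U'.card < U.card → ∀ H' ⊆ H, (∀ e ∈ H', e ⊆ U') → H'.card ≤ X U'.card :=
    fun U' _ h2 H' h3 h4 => ih U'.card (by omega) H' U' (hP.mono h3) h4 rfl
  have triv := triv_bound hP.1 hU
  have star : ∀ v ∈ U, ∀ w < 3, (H.filter (v ∉ ·)).card ≤ w.choose 3 → H.card ≤ (n - 1).choose 2 := by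
    intro v hv w hw h
    have h1 := deg_add H v
    have h2 := deg_bound hP.1 hU hv
    rw [Nat.choose_eq_zero_of_lt hw] at h
    rw [hn] at h2
    omega
  have split : ∀ S ⊆ U, S.card = 6 → (∀ e ∈ H, e ⊆ S ∨ Disjoint e S) → H.card ≤ 20 + X (n - 6) := by
    intro S hS h6 h
    rw [split_bound hP.1 hU h]
    have h1 : (H.filter (· ⊆ S)).card ≤ S.card.choose 3 :=
      triv_bound (fun e he => hP.1 e (Finset.mem_filter.1 he).1) (fun e he => (Finset.mem_filter.1 he).2)
    rw [h6] at h1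
    change _ ≤ 20 at h1
    have h2 := ih (n - 6) (by have := Finset.card_le_card hS; omega) (H.filter (· ⊆ U \ S)) (U \ S)
      (hP.mono (Finset.filter_subset _ _)) (fun e he => (Finset.mem_filter.1 he).2)
      (by rw [Finset.card_sdiff_of_subset hS]; omega)
    omega
  rw [hn] at triv
  by_cases c7 : n = 7
  · subst c7
    rcases step hP hU hX hn (show Ok 7 20 9 0 by decide +kernel) with h | ⟨S, h1, h2, h3⟩ | ⟨v, hv, w, hw, h⟩
    · exact h
    · exact (split S h1 h2 h3).trans (by decide)
    · omega
  by_cases c8 : n = 8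
  · subst c8
    rcases step hP hU hX hn (show Ok 8 24 10 0 by decide +kernel) with h | ⟨S, h1, h2, h3⟩ | ⟨v, hv, w, hw, h⟩
    · exact h
    · exact (split S h1 h2 h3).trans (by decide)
    · omega
  by_cases c9 : n = 9
  · subst c9
    rcases step hP hU hX hn (show Ok 9 25 9 3 by decide +kernel) with h | ⟨S, h1, h2, h3⟩ | ⟨v, hv, w, hw, h⟩
    · exact h.trans (by decide)
    · exact (split S h1 h2 h3).trans (by decide)
    · exact (star v hv w hw h).trans (by decide)
  by_cases c10 : n = 10
  · subst c10
    rcases step hP hU hX hn (show Ok 10 28 9 3 by decide +kernel) with h | ⟨S, h1, h2, h3⟩ | ⟨v, hv, w, hw, h⟩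
    · exact h.trans (by decide)
    · exact (split S h1 h2 h3).trans (by decide)
    · exact (star v hv w hw h).trans (by decide)
  rw [X]
  simp only [c7, c8, c9, c10, if_false]
  exact triv

theorem hXX {H : Finset (Finset V)} (hP : PF H) {U : Finset V} :
    ∀ U' ⊆ U, U'.card < U.card → ∀ H' ⊆ H, (∀ e ∈ H', e ⊆ U') → H'.card ≤ X U'.card :=
  fun U' _ _ H' h3 h4 => Xb U'.card H' U' (hP.mono h3) h4 rfl

theorem splitX {H : Finset (Finset V)} (hP : PF H) {U S : Finset V} (hU : ∀ e ∈ H, e ⊆ U)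
    (hS : S ⊆ U) (h6 : S.card = 6) (h : ∀ e ∈ H, e ⊆ S ∨ Disjoint e S) :
    H.card = (H.filter (· ⊆ S)).card + (H.filter (· ⊆ U \ S)).card ∧
    (H.filter (· ⊆ S)).card ≤ 20 ∧ (H.filter (· ⊆ U \ S)).card ≤ X (U.card - 6) := by
  refine ⟨split_bound hP.1 hU h, ?_, ?_⟩
  · have h1 : (H.filter (· ⊆ S)).card ≤ S.card.choose 3 :=
      triv_bound (fun e he => hP.1 e (Finset.mem_filter.1 he).1) (fun e he => (Finset.mem_filter.1 he).2)
    rw [h6] at h1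
    exact h1
  · exact Xb (U.card - 6) (H.filter (· ⊆ U \ S)) (U \ S)
      (hP.mono (Finset.filter_subset _ _)) (fun e he => (Finset.mem_filter.1 he).2)
      (by rw [Finset.card_sdiff_of_subset hS]; omega)

/-- starlike conclusion when no split is possible -/
theorem T_star {H : Finset (Finset V)} (hP : PF H) {U : Finset V} (hU : ∀ e ∈ H, e ⊆ U)
    {n B d0 w0 : ℕ} (hn : U.card = n) (ok : Ok n B d0 (w0 + 1)) (hB : 20 + X (n - 6) ≤ B)
    (hH : B < H.card) : ∃ v ∈ U, (H.filter (v ∉ ·)).card ≤ w0.choose 3 := by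
  rcases step hP hU (hXX hP) hn ok with h | ⟨S, h1, h2, h3⟩ | ⟨v, hv, w, hw, h⟩
  · omega
  · have := splitX hP hU h1 h2 h3
    rw [hn] at this
    omega
  · exact ⟨v, hv, h.trans (Nat.choose_le_choose _ (by omega))⟩

theorem T9 {H : Finset (Finset V)} (hP : PF H) {U : Finset V} (hU : ∀ e ∈ H, e ⊆ U)
    (hn : U.card = 9) (hH : 25 < H.card) : ∃ v ∈ U, (H.filter (v ∉ ·)).card ≤ 0 :=
  T_star hP hU hn (show Ok 9 25 9 (2 + 1) by decide +kernel) (by decide) hH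
theorem T10 {H : Finset (Finset V)} (hP : PF H) {U : Finset V} (hU : ∀ e ∈ H, e ⊆ U)
    (hn : U.card = 10) (hH : 28 < H.card) : ∃ v ∈ U, (H.filter (v ∉ ·)).card ≤ 0 :=
  T_star hP hU hn (show Ok 10 28 9 (2 + 1) by decide +kernel) (by decide) hH
theorem T11 {H : Finset (Finset V)} (hP : PF H) {U : Finset V} (hU : ∀ e ∈ H, e ⊆ U)
    (hn : U.card = 11) (hH : 31 < H.card) : ∃ v ∈ U, (H.filter (v ∉ ·)).card ≤ 0 :=
  T_star hP hU hn (show Ok 11 31 9 (2 + 1) by decide +kernel) (by decide) hH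
theorem T14 {H : Finset (Finset V)} (hP : PF H) {U : Finset V} (hU : ∀ e ∈ H, e ⊆ U)
    (hn : U.card = 14) (hH : 44 < H.card) : ∃ v ∈ U, (H.filter (v ∉ ·)).card ≤ 1 :=
  T_star hP hU hn (show Ok 14 44 10 (3 + 1) by decide +kernel) (by decide) hH
theorem T15 {H : Finset (Finset V)} (hP : PF H) {U : Finset V} (hU : ∀ e ∈ H, e ⊆ U)
    (hn : U.card = 15) (hH : 50 < H.card) : ∃ v ∈ U, (H.filter (v ∉ ·)).card ≤ 1 :=
  T_star hP hU hn (show Ok 15 50 11 (3 + 1) by decide +kernel) (by decide) hH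

theorem T12 {H : Finset (Finset V)} (hP : PF H) {U : Finset V} (hU : ∀ e ∈ H, e ⊆ U)
    (hn : U.card = 12) (hH : 32 < H.card) : (∃ v ∈ U, (H.filter (v ∉ ·)).card ≤ 0) ∨
      ∃ S ⊆ U, S.card = 6 ∧ ∀ e ∈ H, e ⊆ S ∨ Disjoint e S := by
  rcases step hP hU (hXX hP) hn (show Ok 12 32 9 3 by decide +kernel) with h | h | ⟨v, hv, w, hw, h⟩
  · omega
  · exact Or.inr h
  · exact Or.inl ⟨v, hv, h.trans (by rw [Nat.choose_eq_zero_of_lt hw])⟩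

theorem full_deg {H : Finset (Finset V)} (h3 : ∀ e ∈ H, e.card = 3) {S : Finset V} (h6 : S.card = 6)
    (h20 : 20 ≤ (H.filter (· ⊆ S)).card) {v : V} (hv : v ∈ S) :
    ((H.filter (· ⊆ S)).filter (v ∈ ·)).card = 10 := by
  have hsub : H.filter (· ⊆ S) ⊆ Finset.powersetCard 3 S := by
    intro e he
    rw [Finset.mem_filter] at he
    rw [Finset.mem_powersetCard]; exact ⟨he.2, h3 e he.1⟩
  have hc : (Finset.powersetCard 3 S).card = 20 := by
    rw [Finset.card_powersetCard, h6]; rfl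
  have heq := Finset.eq_of_subset_of_card_le hsub (by omega)
  rw [heq]
  have h1 := Finset.card_filter_add_card_filter_not (s := Finset.powersetCard 3 S) (v ∈ ·)
  have h2 : (Finset.powersetCard 3 S).filter (v ∉ ·) = Finset.powersetCard 3 (S.erase v) := by
    ext e
    simp only [Finset.mem_filter, Finset.mem_powersetCard]
    constructor
    · rintro ⟨⟨p, q⟩, r⟩
      exact ⟨Finset.subset_erase.2 ⟨p, r⟩, q⟩
    · rintro ⟨p, q⟩
      obtain ⟨p1, p2⟩ := Finset.subset_erase.1 p
      exact ⟨⟨p1, q⟩, p2⟩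
  rw [h2, Finset.card_powersetCard, Finset.card_erase_of_mem hv, h6, hc] at h1
  change _ + 10 = 20 at h1
  omega

theorem deg_split_in {H : Finset (Finset V)} {S : Finset V}
    (h : ∀ e ∈ H, e ⊆ S ∨ Disjoint e S) {v : V} (hv : v ∈ S) :
    deg H v = ((H.filter (· ⊆ S)).filter (v ∈ ·)).card := by
  unfold deg
  congr 1
  ext e
  simp only [Finset.mem_filter]
  constructor
  · rintro ⟨p, q⟩
    refine ⟨⟨p, (h e p).resolve_right (fun hd => Finset.disjoint_left.1 hd q hv)⟩, q⟩
  · rintro ⟨⟨p, _⟩, q⟩; exact ⟨p, q⟩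

theorem deg_split_out {H : Finset (Finset V)} {U S : Finset V} (hU : ∀ e ∈ H, e ⊆ U)
    (h : ∀ e ∈ H, e ⊆ S ∨ Disjoint e S) {v : V} (hv : v ∉ S) :
    deg H v = ((H.filter (· ⊆ U \ S)).filter (v ∈ ·)).card := by
  unfold deg
  congr 1
  ext e
  simp only [Finset.mem_filter]
  constructor
  · rintro ⟨p, q⟩
    refine ⟨⟨p, Finset.subset_sdiff.2 ⟨hU e p, (h e p).resolve_left (fun hd => hv (hd q))⟩⟩, q⟩
  · rintro ⟨⟨p, _⟩, q⟩; exact ⟨p, q⟩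

theorem T7 {H : Finset (Finset V)} (hP : PF H) {U : Finset V} (hU : ∀ e ∈ H, e ⊆ U)
    (hn : U.card = 7) (hH : 20 ≤ H.card) : ∀ v, deg H v = 0 ∨ deg H v = 10 := by
  rcases step hP hU (hXX hP) hn (show Ok 7 19 9 0 by decide +kernel) with h | ⟨S, h1, h2, h3⟩ | ⟨v, hv, w, hw, h⟩
  · omega
  · obtain ⟨p, q, _⟩ := splitX hP hU h1 h2 h3
    have r : (H.filter (· ⊆ U \ S)).card ≤ (U \ S).card.choose 3 :=
      triv_bound (fun e he => hP.1 e (Finset.mem_filter.1 he).1) (fun e he => (Finset.mem_filter.1 he).2)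
    rw [Finset.card_sdiff_of_subset h1, hn, h2] at r
    change _ ≤ 0 at r
    intro v
    by_cases hv : v ∈ S
    · right
      rw [deg_split_in h3 hv, full_deg hP.1 h2 (by omega) hv]
    · left
      rw [deg_split_out hU h3 hv]
      have := Finset.card_le_card (Finset.filter_subset (v ∈ ·) (H.filter (· ⊆ U \ S)))
      omega
  · omega

theorem T13 {H : Finset (Finset V)} (hP : PF H) {U : Finset V} (hU : ∀ e ∈ H, e ⊆ U)
    (hn : U.card = 13) (hH : 39 < H.card) : (∃ v ∈ U, (H.filter (v ∉ ·)).card ≤ 1) ∨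
      (H.card = 40 ∧ ∀ v, deg H v = 0 ∨ deg H v = 10) := by
  rcases step hP hU (hXX hP) hn (show Ok 13 39 10 4 by decide +kernel) with h | ⟨S, h1, h2, h3⟩ | ⟨v, hv, w, hw, h⟩
  · omega
  · right
    obtain ⟨p, q, r⟩ := splitX hP hU h1 h2 h3
    rw [hn] at r
    change _ ≤ 20 at r
    refine ⟨by omega, fun v => ?_⟩
    by_cases hv : v ∈ S
    · right
      rw [deg_split_in h3 hv, full_deg hP.1 h2 (by omega) hv]
    · rw [deg_split_out hU h3 hv]
      exact T7 (hP.mono (Finset.filter_subset _ _)) (U := U \ S)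
        (fun e he => (Finset.mem_filter.1 he).2)
        (by rw [Finset.card_sdiff_of_subset h1, hn, h2]) (by omega) v
  · exact Or.inl ⟨v, hv, h.trans (Nat.choose_le_choose 3 (show w ≤ 3 by omega))⟩

theorem T10full {H : Finset (Finset V)} (hP : PF H) {U : Finset V} (hU : ∀ e ∈ H, e ⊆ U)
    (hn : U.card = 10) (hH : 36 ≤ H.card) : ∀ v, Even (deg H v) := by
  obtain ⟨v, hv, h0⟩ := T10 hP hU hn (by omega)
  have h1 := deg_add H v
  have h2 := deg_bound hP.1 hU hv
  rw [hn] at h2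
  change _ ≤ 36 at h2
  have hsub : H ⊆ (Finset.powersetCard 2 (U.erase v)).image (insert v) := by
    intro e he
    have hve : v ∈ e := by
      by_contra hve
      have : 0 < (H.filter (v ∉ ·)).card := Finset.card_pos.2 ⟨e, Finset.mem_filter.2 ⟨he, hve⟩⟩
      omega
    rw [Finset.mem_image]
    refine ⟨e.erase v, ?_, Finset.insert_erase hve⟩
    rw [Finset.mem_powersetCard]
    exact ⟨Finset.erase_subset_erase _ (hU e he), by rw [Finset.card_erase_of_mem hve, hP.1 e he]⟩
  have hc : (Finset.powersetCard 2 (U.erase v)).card = 36 := by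
    rw [Finset.card_powersetCard, Finset.card_erase_of_mem hv, hn]; rfl
  have heq := Finset.eq_of_subset_of_card_le hsub (Finset.card_image_le.trans (by omega))
  intro u
  by_cases huv : u = v
  · subst huv
    rw [show deg H u = 36 by omega]; decide
  by_cases hu : u ∈ U
  · have : deg H u ≤ 8 := by
      have hs : H.filter (u ∈ ·) ⊆ ((U.erase v).erase u).image (fun t => {v, u, t}) := by
        intro e he
        rw [Finset.mem_filter] at he
        have hve : v ∈ e := by
          by_contra hve
          have : 0 < (H.filter (v ∉ ·)).card := Finset.card_pos.2 ⟨e, Finset.mem_filter.2 ⟨he.1, hve⟩⟩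
          omega
        obtain ⟨t, h1, h2, q⟩ := split2 (hP.1 e he.1) hve he.2 (Ne.symm huv)
        rw [Finset.mem_image]
        refine ⟨t, ?_, by rw [q]; ext; simp; tauto⟩
        rw [Finset.mem_erase, Finset.mem_erase]
        exact ⟨h2, h1, hU e he.1 (by rw [q]; simp)⟩
      refine (Finset.card_le_card hs).trans (Finset.card_image_le.trans ?_)
      rw [Finset.card_erase_of_mem (Finset.mem_erase.2 ⟨huv, hu⟩), Finset.card_erase_of_mem hv, hn]
    have h8 : 8 ≤ deg H u := by
      have hs : ((U.erase v).erase u).image (fun t => {v, u, t}) ⊆ H.filter (u ∈ ·) := by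
        intro e he
        obtain ⟨t, ht, rfl⟩ := Finset.mem_image.1 he
        rw [Finset.mem_erase, Finset.mem_erase] at ht
        rw [Finset.mem_filter, heq]
        refine ⟨Finset.mem_image.2 ⟨{u, t}, ?_, rfl⟩, by simp⟩
        rw [Finset.mem_powersetCard]
        refine ⟨?_, Finset.card_pair (Ne.symm ht.1)⟩
        intro s hs
        rw [Finset.mem_insert, Finset.mem_singleton] at hs
        rw [Finset.mem_erase]
        rcases hs with rfl | rfl
        · exact ⟨huv, hu⟩
        · exact ht.2
      have h3 := Finset.card_le_card hs
      rw [Finset.card_image_of_injOn, Finset.card_erase_of_mem (Finset.mem_erase.2 ⟨huv, hu⟩),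
        Finset.card_erase_of_mem hv, hn] at h3
      · exact h3
      · intro s hs t ht hst
        simp only [Finset.coe_erase, Set.mem_sdiff, Finset.mem_coe, Set.mem_singleton_iff] at hs ht hst
        have : s ∈ ({v, u, t} : Finset V) := by rw [← hst]; simp
        simp at this
        tauto
    rw [show deg H u = 8 by omega]; decide
  · have : deg H u = 0 := by
      unfold deg
      rw [Finset.card_eq_zero, Finset.filter_eq_empty_iff]
      intro e he hue
      exact hu (hU e he hue)
    rw [this]; decide

theorem T16 {H : Finset (Finset V)} (hP : PF H) {U : Finset V} (hU : ∀ e ∈ H, e ⊆ U)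
    (hn : U.card = 16) (hH : 55 < H.card) : (∃ v ∈ U, (H.filter (v ∉ ·)).card ≤ 4) ∨
      (H.card = 56 ∧ ∀ v, Even (deg H v)) := by
  rcases step hP hU (hXX hP) hn (show Ok 16 55 11 5 by decide +kernel) with h | ⟨S, h1, h2, h3⟩ | ⟨v, hv, w, hw, h⟩
  · omega
  · right
    obtain ⟨p, q, r⟩ := splitX hP hU h1 h2 h3
    rw [hn] at r
    change _ ≤ 36 at r
    refine ⟨by omega, fun v => ?_⟩
    by_cases hv : v ∈ S
    · rw [deg_split_in h3 hv, full_deg hP.1 h2 (by omega) hv]; decide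
    · rw [deg_split_out hU h3 hv]
      exact T10full (hP.mono (Finset.filter_subset _ _)) (U := U \ S)
        (fun e he => (Finset.mem_filter.1 he).2)
        (by rw [Finset.card_sdiff_of_subset h1, hn, h2]) (by omega) v
  · exact Or.inl ⟨v, hv, h.trans (Nat.choose_le_choose 3 (show w ≤ 4 by omega))⟩

theorem T8 {H : Finset (Finset V)} (hP : PF H) {U : Finset V} (hU : ∀ e ∈ H, e ⊆ U)
    (hn : U.card = 8) : H.card ≤ 24 := Xb 8 H U hP hU hn
end LP

namespace LP
variable {V : Type} [DecidableEq V]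

/-- triples inside `U` that are not split by `S` -/
def DD (U S : Finset V) : Finset (Finset V) := Finset.powersetCard 3 S ∪ Finset.powersetCard 3 (U \ S)

theorem pow_disj {A B : Finset V} (h : Disjoint A B) :
    Disjoint (Finset.powersetCard 3 A) (Finset.powersetCard 3 B) := by
  rw [Finset.disjoint_left]
  intro e h1 h2
  rw [Finset.mem_powersetCard] at h1 h2
  have : Disjoint e e := h.mono h1.1 h2.1
  rw [Finset.disjoint_self_iff_empty] at this
  rw [this] at h1
  simp at h1

theorem mem_DD {U S e : Finset V} : e ∈ DD U S ↔ e.card = 3 ∧ (e ⊆ S ∨ e ⊆ U \ S) := by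
  simp only [DD, Finset.mem_union, Finset.mem_powersetCard]; tauto

theorem DD_card {U S : Finset V} (hU : U.card = 12) (hS : S ⊆ U) (h6 : S.card = 6) :
    (DD U S).card = 40 := by
  rw [DD, Finset.card_union_of_disjoint (pow_disj Finset.disjoint_sdiff), Finset.card_powersetCard,
    Finset.card_powersetCard, Finset.card_sdiff_of_subset hS, hU, h6]
  rfl

theorem cells {U S T : Finset V} (hU : U.card = 12) (hS : S ⊆ U) (h6 : S.card = 6)
    (hT : T ⊆ U) (h6' : T.card = 6) :
    (S ∩ T).card ≤ 6 ∧ (S \ T).card = 6 - (S ∩ T).card ∧ (T \ S).card = 6 - (S ∩ T).card ∧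
      (U \ (S ∪ T)).card = (S ∩ T).card := by
  have h1 := Finset.card_inter_add_card_sdiff S T
  have h2 := Finset.card_inter_add_card_sdiff T S
  rw [Finset.inter_comm] at h2
  have h3 := Finset.card_sdiff_of_subset (Finset.union_subset hS hT)
  have h4 := Finset.card_union_add_card_inter S T
  omega

theorem ovl {U S T : Finset V} (hU : U.card = 12) (hS : S ⊆ U) (h6 : S.card = 6)
    (hT : T ⊆ U) (h6' : T.card = 6) :
    2 * (S ∩ T).card.choose 3 + 2 * (6 - (S ∩ T).card).choose 3 ≤ (DD U S ∩ DD U T).card := by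
  obtain ⟨h0, h1, h2, h3⟩ := cells hU hS h6 hT h6'
  have hsub : (Finset.powersetCard 3 (S ∩ T) ∪ Finset.powersetCard 3 (S \ T)) ∪
      (Finset.powersetCard 3 (T \ S) ∪ Finset.powersetCard 3 (U \ (S ∪ T))) ⊆ DD U S ∩ DD U T := by
    intro e he
    simp only [Finset.mem_union, Finset.mem_inter, Finset.mem_powersetCard, mem_DD,
      Finset.subset_iff, Finset.mem_sdiff] at he ⊢
    rcases he with (⟨p, q⟩ | ⟨p, q⟩) | (⟨p, q⟩ | ⟨p, q⟩)
    · exact ⟨⟨q, Or.inl fun x hx => (p hx).1⟩, ⟨q, Or.inl fun x hx => (p hx).2⟩⟩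
    · exact ⟨⟨q, Or.inl fun x hx => (p hx).1⟩, ⟨q, Or.inr fun x hx => ⟨hS (p hx).1, (p hx).2⟩⟩⟩
    · exact ⟨⟨q, Or.inr fun x hx => ⟨hT (p hx).1, (p hx).2⟩⟩, ⟨q, Or.inl fun x hx => (p hx).1⟩⟩
    · exact ⟨⟨q, Or.inr fun x hx => ⟨(p hx).1, fun h => (p hx).2 (Or.inl h)⟩⟩,
        ⟨q, Or.inr fun x hx => ⟨(p hx).1, fun h => (p hx).2 (Or.inr h)⟩⟩⟩
  have hc := Finset.card_le_card hsub
  have d1 : Disjoint (S ∩ T) (S \ T) := by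
    rw [Finset.disjoint_left]; intro x; simp only [Finset.mem_inter, Finset.mem_sdiff]; tauto
  have d2 : Disjoint (T \ S) (U \ (S ∪ T)) := by
    rw [Finset.disjoint_left]; intro x; simp only [Finset.mem_union, Finset.mem_sdiff]; tauto
  have d3 : Disjoint (Finset.powersetCard 3 (S ∩ T) ∪ Finset.powersetCard 3 (S \ T))
      (Finset.powersetCard 3 (T \ S) ∪ Finset.powersetCard 3 (U \ (S ∪ T))) := by
    rw [Finset.disjoint_union_left, Finset.disjoint_union_right, Finset.disjoint_union_right]
    refine ⟨⟨pow_disj ?_, pow_disj ?_⟩, ⟨pow_disj ?_, pow_disj ?_⟩⟩ <;>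
    · rw [Finset.disjoint_left]; intro x
      simp only [Finset.mem_union, Finset.mem_inter, Finset.mem_sdiff]; tauto
  rw [Finset.card_union_of_disjoint d3, Finset.card_union_of_disjoint (pow_disj d1),
    Finset.card_union_of_disjoint (pow_disj d2)] at hc
  simp only [Finset.card_powersetCard, h1, h2, h3] at hc
  omega

theorem num_ov {a : ℕ} (h : a ≤ 6) : 4 ≤ 2 * a.choose 3 + 2 * (6 - a).choose 3 ∧
    (a ≠ 3 → 8 ≤ 2 * a.choose 3 + 2 * (6 - a).choose 3) ∧
    (a ≠ 2 → a ≠ 3 → a ≠ 4 → 12 ≤ 2 * a.choose 3 + 2 * (6 - a).choose 3) := by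
  interval_cases a <;> decide

theorem unb {U S T R : Finset V} (hU : U.card = 12) (hS : S ⊆ U) (h6 : S.card = 6)
    (hT : T ⊆ U) (h6' : T.card = 6) (hR : R ⊆ U) (h6'' : R.card = 6)
    (ha : (S ∩ T).card = 2 ∨ (S ∩ T).card = 4) : (DD U R \ (DD U S ∪ DD U T)).card ≤ 35 := by
  by_contra hlt
  have c := DD_card hU hR h6''
  have h1 := Finset.card_inter_add_card_sdiff (DD U R) (DD U S ∪ DD U T)
  have o1 := ovl hU hR h6'' hS h6
  have o2 := ovl hU hR h6'' hT h6'
  have n1 := num_ov (cells hU hR h6'' hS h6).1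
  have n2 := num_ov (cells hU hR h6'' hT h6').1
  have e1 : DD U R ∩ DD U S = DD U R ∩ (DD U S ∪ DD U T) :=
    Finset.eq_of_subset_of_card_le (Finset.inter_subset_inter_left Finset.subset_union_left) (by omega)
  have e2 : DD U R ∩ DD U T = DD U R ∩ (DD U S ∪ DD U T) :=
    Finset.eq_of_subset_of_card_le (Finset.inter_subset_inter_left Finset.subset_union_right) (by omega)
  have hb : (R ∩ S).card = 3 := by
    by_contra hne
    have := n1.2.1 hne
    rw [e1] at o1
    omega
  have cl := cells hU hR h6'' hS h6
  have m1 : R ∩ S ∈ DD U R ∩ DD U S := by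
    rw [Finset.mem_inter, mem_DD, mem_DD]
    exact ⟨⟨hb, Or.inl Finset.inter_subset_left⟩, ⟨hb, Or.inl Finset.inter_subset_right⟩⟩
  have m2 : S \ R ∈ DD U R ∩ DD U S := by
    rw [Finset.mem_inter, mem_DD, mem_DD]
    exact ⟨⟨by omega, Or.inr (Finset.sdiff_subset_sdiff hS (Finset.Subset.refl _))⟩,
      ⟨by omega, Or.inl Finset.sdiff_subset⟩⟩
  rw [e1, ← e2, Finset.mem_inter, mem_DD, mem_DD] at m1 m2
  have q1 : ((R ∩ S) ∩ T).card = 0 ∨ ((R ∩ S) ∩ T).card = 3 := by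
    rcases m1.2.2 with h | h
    · right; rw [Finset.inter_eq_left.2 h, hb]
    · left
      rw [Finset.card_eq_zero, ← Finset.disjoint_iff_inter_eq_empty]
      exact (Finset.subset_sdiff.1 h).2
  have q2 : ((S \ R) ∩ T).card = 0 ∨ ((S \ R) ∩ T).card = 3 := by
    rcases m2.2.2 with h | h
    · right; rw [Finset.inter_eq_left.2 h]; omega
    · left
      rw [Finset.card_eq_zero, ← Finset.disjoint_iff_inter_eq_empty]
      exact (Finset.subset_sdiff.1 h).2
  have q3 : (S ∩ T).card = ((R ∩ S) ∩ T).card + ((S \ R) ∩ T).card := by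
    clear * -
    rw [← Finset.card_union_of_disjoint]
    · congr 1; ext x; simp only [Finset.mem_union, Finset.mem_inter, Finset.mem_sdiff]; tauto
    · rw [Finset.disjoint_left]; intro x; simp only [Finset.mem_inter, Finset.mem_sdiff]; tauto
  omega

theorem bal_core {U X Y W e : Finset V} (hU : U.card = 12) (hX : X ⊆ U) (hX6 : X.card = 6)
    (hY : Y ⊆ U) (hY6 : Y.card = 6) (hW : W ⊆ U) (hW6 : W.card = 6)
    (b1 : (X ∩ Y).card = 3) (b2 : (X ∩ W).card = 3) (b3 : (Y ∩ W).card = 3)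
    (he : e.card = 3) (eX : e ⊆ X) (eY : e ⊆ Y) (eW : e ⊆ W) :
    ∀ t ∈ U, t ∈ W ↔ (t ∈ X ↔ t ∈ Y) := by
  have q1 := Finset.eq_of_subset_of_card_le (Finset.subset_inter eX eY) (by omega)
  have q2 := Finset.eq_of_subset_of_card_le (Finset.subset_inter eX eW) (by omega)
  have q3 := Finset.eq_of_subset_of_card_le (Finset.subset_inter eY eW) (by omega)
  have hsub : W ⊆ U.filter (fun t => t ∈ X ↔ t ∈ Y) := by
    intro t ht
    rw [Finset.mem_filter]
    refine ⟨hW ht, fun h => ?_, fun h => ?_⟩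
    · have : t ∈ e := by rw [q2, Finset.mem_inter]; exact ⟨h, ht⟩
      exact eY this
    · have : t ∈ e := by rw [q3, Finset.mem_inter]; exact ⟨h, ht⟩
      exact eX this
  have hc : (U.filter (fun t => t ∈ X ↔ t ∈ Y)).card ≤ 6 := by
    have : U.filter (fun t => t ∈ X ↔ t ∈ Y) = (X ∩ Y) ∪ (U \ (X ∪ Y)) := by
      ext t
      have := @hX t
      have := @hY t
      simp only [Finset.mem_filter, Finset.mem_union, Finset.mem_inter, Finset.mem_sdiff]
      tauto
    rw [this]
    have := cells hU hX hX6 hY hY6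
    refine (Finset.card_union_le _ _).trans (by omega)
  have heq := Finset.eq_of_subset_of_card_le hsub (by omega)
  intro t ht
  rw [heq, Finset.mem_filter]
  tauto

theorem bal_compl {U S T : Finset V} (hU : U.card = 12) (hS : S ⊆ U) (h6 : S.card = 6)
    (hT : T ⊆ U) (h6' : T.card = 6) (b : (S ∩ T).card = 3) :
    ∀ X Y, (X = S ∨ X = U \ S) → (Y = T ∨ Y = U \ T) → (X ∩ Y).card = 3 := by
  have c := cells hU hS h6 hT h6'
  rintro X Y (rfl | rfl) (rfl | rfl)
  · exact b
  · rw [show X ∩ (U \ T) = X \ T by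
      ext t; have := @hS t; simp only [Finset.mem_inter, Finset.mem_sdiff]; tauto]
    omega
  · rw [show (U \ S) ∩ Y = Y \ S by
      ext t; have := @hT t; simp only [Finset.mem_inter, Finset.mem_sdiff]; tauto]
    omega
  · rw [show (U \ S) ∩ (U \ T) = U \ (S ∪ T) by
      ext t; simp only [Finset.mem_inter, Finset.mem_sdiff, Finset.mem_union]; tauto]
    omega

theorem side {U S e : Finset V} (hU : U.card = 12) (hS : S ⊆ U) (h6 : S.card = 6) (he : e ∈ DD U S) :
    ∃ X, (X = S ∨ X = U \ S) ∧ e ⊆ X ∧ X ⊆ U ∧ X.card = 6 := by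
  rcases (mem_DD.1 he).2 with h | h
  · exact ⟨S, Or.inl rfl, h, hS, h6⟩
  · exact ⟨U \ S, Or.inr rfl, h, Finset.sdiff_subset, by rw [Finset.card_sdiff_of_subset hS, hU, h6]⟩

theorem bal_three {U S T R e : Finset V} (hU : U.card = 12) (hS : S ⊆ U) (h6 : S.card = 6)
    (hT : T ⊆ U) (h6' : T.card = 6) (hR : R ⊆ U) (h6'' : R.card = 6)
    (b1 : (S ∩ T).card = 3) (b2 : (S ∩ R).card = 3) (b3 : (T ∩ R).card = 3)
    (e1 : e ∈ DD U S) (e2 : e ∈ DD U T) (e3 : e ∈ DD U R) :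
    (∀ t ∈ U, t ∈ R ↔ (t ∈ S ↔ t ∈ T)) ∨ (∀ t ∈ U, t ∉ R ↔ (t ∈ S ↔ t ∈ T)) := by
  obtain ⟨X, x1, x2, x3, x4⟩ := side hU hS h6 e1
  obtain ⟨Y, y1, y2, y3, y4⟩ := side hU hT h6' e2
  obtain ⟨W, w1, w2, w3, w4⟩ := side hU hR h6'' e3
  have key := bal_core hU x3 x4 y3 y4 w3 w4 (bal_compl hU hS h6 hT h6' b1 X Y x1 y1)
    (bal_compl hU hS h6 hR h6'' b2 X W x1 w1) (bal_compl hU hT h6' hR h6'' b3 Y W y1 w1)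
    (mem_DD.1 e1).1 x2 y2 w2
  rcases x1 with rfl | rfl <;> rcases y1 with rfl | rfl <;> rcases w1 with rfl | rfl
  case inl.inl.inl | inr.inr.inl | inl.inr.inr | inr.inl.inr =>
    left; intro t ht
    have := key t ht
    clear * - this ht
    try simp only [Finset.mem_sdiff, ht, true_and] at this
    tauto
  all_goals
    right; intro t ht
    have := key t ht
    clear * - this ht
    try simp only [Finset.mem_sdiff, ht, true_and] at this
    tauto

theorem bal_four {U S T R R' e e' : Finset V} (hU : U.card = 12) (hS : S ⊆ U) (h6 : S.card = 6)
    (hT : T ⊆ U) (h6' : T.card = 6) (hR : R ⊆ U) (h6'' : R.card = 6) (hR' : R' ⊆ U) (h6''' : R'.card = 6)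
    (b1 : (S ∩ T).card = 3) (b2 : (S ∩ R).card = 3) (b3 : (T ∩ R).card = 3)
    (b4 : (S ∩ R').card = 3) (b5 : (T ∩ R').card = 3) (b6 : (R ∩ R').card = 3)
    (e1 : e ∈ DD U S) (e2 : e ∈ DD U T) (e3 : e ∈ DD U R)
    (e4 : e' ∈ DD U S) (e5 : e' ∈ DD U T) (e6 : e' ∈ DD U R') : False := by
  have same : (∀ t ∈ U, t ∈ R ↔ t ∈ R') → False := by
    intro h
    have : R ∩ R' = R := by
      rw [Finset.inter_eq_left]; intro t ht; exact (h t (hR ht)).1 ht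
    rw [this] at b6; omega
  have opp : (∀ t ∈ U, t ∈ R ↔ t ∉ R') → False := by
    intro h
    have : R ∩ R' = ∅ := by
      rw [← Finset.disjoint_iff_inter_eq_empty, Finset.disjoint_left]
      intro t ht; exact (h t (hR ht)).1 ht
    rw [this] at b6; simp at b6
  rcases bal_three hU hS h6 hT h6' hR h6'' b1 b2 b3 e1 e2 e3 with h | h <;>
  rcases bal_three hU hS h6 hT h6' hR' h6''' b1 b4 b5 e4 e5 e6 with h' | h'
  · exact same fun t ht => by rw [h t ht, h' t ht]
  · exact opp fun t ht => by rw [h t ht, h' t ht]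
  · exact opp fun t ht => by have := h t ht; have := h' t ht; tauto
  · exact same fun t ht => by have := h t ht; have := h' t ht; tauto

theorem union_bound {C : Type} [DecidableEq C] {U : Finset V} (hU : U.card = 12) (Q : Finset C)
    (S : C → Finset V) (hS : ∀ i ∈ Q, S i ⊆ U ∧ (S i).card = 6) (hk : Q.card ≤ 6) :
    (Q.biUnion (fun i => DD U (S i))).card + 32 * (6 - Q.card) ≤ 212 := by
  have c40 : ∀ i ∈ Q, (DD U (S i)).card = 40 := fun i hi => DD_card hU (hS i hi).1 (hS i hi).2
  by_cases hk1 : Q.card ≤ 1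
  · have : (Q.biUnion (fun i => DD U (S i))).card ≤ ∑ i ∈ Q, 40 :=
      Finset.card_biUnion_le.trans (Finset.sum_le_sum fun i hi => (c40 i hi).le)
    rw [Finset.sum_const, smul_eq_mul] at this
    omega
  have cov : ∀ i ∈ Q, ∀ j ∈ Q, i ≠ j → (Q.biUnion (fun i => DD U (S i))).card ≤
      (DD U (S i) ∪ DD U (S j)).card +
        ∑ l ∈ (Q.erase i).erase j, (DD U (S l) \ (DD U (S i) ∪ DD U (S j))).card := by
    intro i hi j hj hij
    have hsub : Q.biUnion (fun i => DD U (S i)) ⊆ (DD U (S i) ∪ DD U (S j)) ∪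
        ((Q.erase i).erase j).biUnion (fun l => DD U (S l) \ (DD U (S i) ∪ DD U (S j))) := by
      intro e he
      rw [Finset.mem_biUnion] at he
      obtain ⟨l, hl, hle⟩ := he
      by_cases h : e ∈ DD U (S i) ∪ DD U (S j)
      · exact Finset.mem_union_left _ h
      · apply Finset.mem_union_right
        rw [Finset.mem_biUnion]
        refine ⟨l, ?_, Finset.mem_sdiff.2 ⟨hle, h⟩⟩
        rw [Finset.mem_erase, Finset.mem_erase]
        rw [Finset.mem_union] at h
        exact ⟨by rintro rfl; exact h (Or.inr hle), by rintro rfl; exact h (Or.inl hle), hl⟩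
    exact (Finset.card_le_card hsub).trans ((Finset.card_union_le _ _).trans
      (Nat.add_le_add_left Finset.card_biUnion_le _))
  have ovQ : ∀ i ∈ Q, ∀ j ∈ Q, _ := fun i hi j hj =>
    ovl hU (hS i hi).1 (hS i hi).2 (hS j hj).1 (hS j hj).2
  have numQ : ∀ i ∈ Q, ∀ j ∈ Q, _ := fun i hi j hj =>
    num_ov (cells hU (hS i hi).1 (hS i hi).2 (hS j hj).1 (hS j hj).2).1
  have ercard : ∀ i ∈ Q, ∀ j ∈ Q, i ≠ j → ((Q.erase i).erase j).card = Q.card - 2 := by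
    intro i hi j hj hij
    rw [Finset.card_erase_of_mem (Finset.mem_erase.2 ⟨hij.symm, hj⟩), Finset.card_erase_of_mem hi]
    omega
  have ermem : ∀ i j l, l ∈ (Q.erase i).erase j → l ∈ Q ∧ l ≠ i ∧ l ≠ j := by
    intro i j l hl
    rw [Finset.mem_erase, Finset.mem_erase] at hl
    exact ⟨hl.2.2, hl.2.1, hl.1⟩
  have b36 : ∀ i ∈ Q, ∀ j ∈ Q, ∀ l ∈ Q, (DD U (S l) \ (DD U (S i) ∪ DD U (S j))).card ≤ 36 := by
    intro i hi j hj l hl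
    have h1 := Finset.card_inter_add_card_sdiff (DD U (S l)) (DD U (S i) ∪ DD U (S j))
    have h2 := Finset.card_le_card (Finset.inter_subset_inter_left
      (Finset.subset_union_left : DD U (S i) ⊆ DD U (S i) ∪ DD U (S j)) : DD U (S l) ∩ _ ⊆ _)
    have h3 := ovQ l hl i hi
    have h4 := (numQ l hl i hi).1
    have := c40 l hl
    omega
  by_cases hub : ∃ i ∈ Q, ∃ j ∈ Q, i ≠ j ∧ (S i ∩ S j).card ≠ 3
  · obtain ⟨i, hi, j, hj, hij, hne⟩ := hub
    have h1 := cov i hi j hj hij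
    have h2 := ovQ i hi j hj
    have h3 := numQ i hi j hj
    have h4 := Finset.card_union_add_card_inter (DD U (S i)) (DD U (S j))
    have h5 := c40 i hi
    have h6 := c40 j hj
    have h7 := ercard i hi j hj hij
    by_cases ha : (S i ∩ S j).card = 2 ∨ (S i ∩ S j).card = 4
    · have h8 := h3.2.1 hne
      have h9 : ∑ l ∈ (Q.erase i).erase j, (DD U (S l) \ (DD U (S i) ∪ DD U (S j))).card ≤
          ∑ l ∈ (Q.erase i).erase j, 35 := by
        apply Finset.sum_le_sum
        intro l hl
        have hlQ := (ermem i j l hl).1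
        exact unb hU (hS i hi).1 (hS i hi).2 (hS j hj).1 (hS j hj).2 (hS l hlQ).1 (hS l hlQ).2 ha
      rw [Finset.sum_const, smul_eq_mul, h7] at h9
      omega
    · push Not at ha
      have h8 := h3.2.2 ha.1 hne ha.2
      have h9 : ∑ l ∈ (Q.erase i).erase j, (DD U (S l) \ (DD U (S i) ∪ DD U (S j))).card ≤
          ∑ l ∈ (Q.erase i).erase j, 36 := by
        apply Finset.sum_le_sum
        intro l hl
        exact b36 i hi j hj l (ermem i j l hl).1
      rw [Finset.sum_const, smul_eq_mul, h7] at h9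
      omega
  · push Not at hub
    obtain ⟨i, hi, j, hj, hij⟩ := Finset.one_lt_card.1 (show 1 < Q.card by omega)
    have h1 := cov i hi j hj hij
    have h2 := ovQ i hi j hj
    have h3 := (numQ i hi j hj).1
    have h4 := Finset.card_union_add_card_inter (DD U (S i)) (DD U (S j))
    have h5 := c40 i hi
    have h6 := c40 j hj
    have h7 := ercard i hi j hj hij
    have ex : ∀ l ∈ Q, 32 < (DD U (S l) \ (DD U (S i) ∪ DD U (S j))).card →
        ∃ e, e ∈ DD U (S i) ∧ e ∈ DD U (S j) ∧ e ∈ DD U (S l) := by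
      intro l hl hlt
      by_contra hno
      push Not at hno
      have g1 := Finset.card_inter_add_card_sdiff (DD U (S l)) (DD U (S i) ∪ DD U (S j))
      have g2 := ovQ l hl i hi
      have g3 := ovQ l hl j hj
      have g4 := (numQ l hl i hi).1
      have g5 := (numQ l hl j hj).1
      have g6 := c40 l hl
      have gd : Disjoint (DD U (S l) ∩ DD U (S i)) (DD U (S l) ∩ DD U (S j)) := by
        rw [Finset.disjoint_left]
        intro e p q
        rw [Finset.mem_inter] at p q
        exact hno e p.2 q.2 p.1
      have g7 := Finset.card_union_of_disjoint gd
      rw [← Finset.inter_union_distrib_left] at g7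
      omega
    have main : ∑ l ∈ (Q.erase i).erase j, (DD U (S l) \ (DD U (S i) ∪ DD U (S j))).card ≤
        32 * (Q.card - 2) + 4 := by
      by_cases hall : ∀ l ∈ (Q.erase i).erase j, (DD U (S l) \ (DD U (S i) ∪ DD U (S j))).card ≤ 32
      · have := Finset.sum_le_sum hall
        rw [Finset.sum_const, smul_eq_mul, h7] at this
        omega
      · push Not at hall
        obtain ⟨l0, hl0, hlt⟩ := hall
        obtain ⟨m1, m2, m3⟩ := ermem i j l0 hl0
        obtain ⟨e, e1, e2, e3⟩ := ex l0 m1 hlt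
        rw [← Finset.add_sum_erase _ _ hl0]
        have hothers : ∀ l ∈ ((Q.erase i).erase j).erase l0,
            (DD U (S l) \ (DD U (S i) ∪ DD U (S j))).card ≤ 32 := by
          intro l hl
          rw [Finset.mem_erase] at hl
          obtain ⟨n1, n2, n3⟩ := ermem i j l hl.2
          by_contra hlt'
          push Not at hlt'
          obtain ⟨e', e4, e5, e6⟩ := ex l n1 hlt'
          exact bal_four hU (hS i hi).1 (hS i hi).2 (hS j hj).1 (hS j hj).2 (hS l0 m1).1 (hS l0 m1).2
            (hS l n1).1 (hS l n1).2 (hub i hi j hj hij) (hub i hi l0 m1 m2.symm) (hub j hj l0 m1 m3.symm)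
            (hub i hi l n1 n2.symm) (hub j hj l n1 n3.symm) (hub l0 m1 l n1 hl.1.symm)
            e1 e2 e3 e4 e5 e6
        have := Finset.sum_le_sum hothers
        rw [Finset.sum_const, smul_eq_mul, Finset.card_erase_of_mem hl0, h7] at this
        have h36 := b36 i hi j hj l0 m1
        have : 0 < Q.card - 2 := by rw [← h7]; exact Finset.card_pos.2 ⟨l0, hl0⟩
        omega
    omega
end LP

namespace LP
variable {V : Type} [DecidableEq V] {C : Type} [DecidableEq C]

def cls (col : Finset V → C) (U : Finset V) (i : C) : Finset (Finset V) :=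
  (Finset.powersetCard 3 U).filter (fun e => col e = i)

def mis (col : Finset V → C) (U : Finset V) (K : Finset C) : Finset (Finset V) :=
  (Finset.powersetCard 3 U).filter (fun e => col e ∉ K)

theorem tot (col : Finset V → C) (K : Finset C) (T : Finset (Finset V)) :
    ∑ i ∈ K, (T.filter (fun e => col e = i)).card + (T.filter (fun e => col e ∉ K)).card = T.card := by
  rw [← Finset.card_filter_add_card_filter_not (s := T) (fun e => col e ∈ K)]
  congr 1
  rw [Finset.card_eq_sum_card_fiberwise (f := col) (t := K)]
  · apply Finset.sum_congr rfl
    intro i hi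
    congr 1
    ext e
    simp only [Finset.mem_filter]
    constructor
    · rintro ⟨h1, rfl⟩; exact ⟨⟨h1, hi⟩, rfl⟩
    · rintro ⟨⟨h1, _⟩, h2⟩; exact ⟨h1, h2⟩
  · intro e he
    exact (Finset.mem_filter.1 he).2

theorem tot_card (col : Finset V → C) (K : Finset C) (U : Finset V) :
    ∑ i ∈ K, (cls col U i).card + (mis col U K).card = U.card.choose 3 := by
  have := tot col K (Finset.powersetCard 3 U)
  rwa [Finset.card_powersetCard] at this

theorem tot_deg (col : Finset V → C) (K : Finset C) (U : Finset V) {v : V} (hv : v ∈ U) :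
    ∑ i ∈ K, deg (cls col U i) v + deg (mis col U K) v + (U.card - 1).choose 3 = U.card.choose 3 := by
  have h := tot col K ((Finset.powersetCard 3 U).filter (v ∈ ·))
  have h1 := Finset.card_filter_add_card_filter_not (s := Finset.powersetCard 3 U) (v ∈ ·)
  have h2 : (Finset.powersetCard 3 U).filter (v ∉ ·) = Finset.powersetCard 3 (U.erase v) := by
    ext e
    simp only [Finset.mem_filter, Finset.mem_powersetCard]
    constructor
    · rintro ⟨⟨p, q⟩, r⟩
      exact ⟨Finset.subset_erase.2 ⟨p, r⟩, q⟩
    · rintro ⟨p, q⟩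
      obtain ⟨p1, p2⟩ := Finset.subset_erase.1 p
      exact ⟨⟨p1, q⟩, p2⟩
  rw [h2, Finset.card_powersetCard, Finset.card_powersetCard, Finset.card_erase_of_mem hv, ← h] at h1
  rw [← h1]
  congr 1
  unfold deg cls mis
  simp only [Finset.filter_comm]

/-- the state in the descent -/
def St (col : Finset V → C) (n k m : ℕ) : Prop :=
  ∃ (U : Finset V) (K : Finset C), U.card = n ∧ K.card = k ∧ (mis col U K).card ≤ m

theorem cls_sub (col : Finset V → C) (U : Finset V) (i : C) : ∀ e ∈ cls col U i, e ⊆ U := by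
  intro e he
  exact (Finset.mem_powersetCard.1 (Finset.mem_filter.1 he).1).1

theorem descend {col : Finset V → C} {U : Finset V} {K : Finset C} {n k m l : ℕ}
    (hU : U.card = n + 1) (hK : K.card = k + 1) (hm : (mis col U K).card ≤ m) {i : C} (hi : i ∈ K)
    {v : V} (hv : v ∈ U) (hl : ((cls col U i).filter (v ∉ ·)).card ≤ l) : St col n k (m + l) := by
  refine ⟨U.erase v, K.erase i, by rw [Finset.card_erase_of_mem hv]; omega,
    by rw [Finset.card_erase_of_mem hi]; omega, ?_⟩
  have hsub : mis col (U.erase v) (K.erase i) ⊆ mis col U K ∪ (cls col U i).filter (v ∉ ·) := by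
    intro e he
    simp only [mis, cls, Finset.mem_filter, Finset.mem_powersetCard, Finset.mem_union,
      Finset.mem_erase, not_and] at he ⊢
    obtain ⟨⟨h1, h2⟩, h3⟩ := he
    obtain ⟨h4, h5⟩ := Finset.subset_erase.1 h1
    by_cases hc : col e = i
    · exact Or.inr ⟨⟨⟨h4, h2⟩, hc⟩, h5⟩
    · exact Or.inl ⟨⟨h4, h2⟩, h3 hc⟩
  have := (Finset.card_le_card hsub).trans (Finset.card_union_le _ _)
  omega

theorem big {col : Finset V → C} {U : Finset V} {K : Finset C} {k m B : ℕ}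
    (hK : K.card = k) (hm : (mis col U K).card ≤ m) (hB : k * B + m < U.card.choose 3) :
    ∃ i ∈ K, B < (cls col U i).card := by
  by_contra hno
  push Not at hno
  have h1 := Finset.sum_le_sum hno
  have h2 := tot_card col K U
  rw [Finset.sum_const, smul_eq_mul, hK] at h1
  omega

theorem easy {col : Finset V → C} (hP : ∀ U i, PF (cls col U i)) {n k m B l : ℕ}
    (h : St col (n + 1) (k + 1) m) (hB : (k + 1) * B + m < (n + 1).choose 3)
    (T : ∀ (H : Finset (Finset V)) (U : Finset V), PF H → (∀ e ∈ H, e ⊆ U) → U.card = n + 1 →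
      B < H.card → ∃ v ∈ U, (H.filter (v ∉ ·)).card ≤ l) : St col n k (m + l) := by
  obtain ⟨U, K, hU, hK, hm⟩ := h
  obtain ⟨i, hi, hc⟩ := big hK hm (hU ▸ hB)
  obtain ⟨v, hv, hl⟩ := T _ U (hP U i) (cls_sub col U i) hU hc
  exact descend hU hK hm hi hv hl

theorem step16 {col : Finset V → C} (hP : ∀ U i, PF (cls col U i)) (h : St col 16 10 0) :
    St col 15 9 4 := by
  obtain ⟨U, K, hU, hK, hm⟩ := h
  by_cases hs : ∃ i ∈ K, ∃ v ∈ U, ((cls col U i).filter (v ∉ ·)).card ≤ 4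
  · obtain ⟨i, hi, v, hv, hl⟩ := hs
    exact descend hU hK hm hi hv hl
  exfalso
  push Not at hs
  have T : ∀ i ∈ K, 55 < (cls col U i).card → (cls col U i).card = 56 ∧ ∀ v, Even (deg (cls col U i) v) := by
    intro i hi hc
    rcases T16 (hP U i) (cls_sub col U i) hU hc with ⟨v, hv, h⟩ | h
    · have := hs i hi v hv; omega
    · exact h
  have hle : ∀ i ∈ K, (cls col U i).card ≤ 56 := by
    intro i hi
    by_contra hlt
    have := (T i hi (by omega)).1
    omega
  have htot := tot_card col K U
  rw [hU, show Nat.choose 16 3 = 560 from rfl] at htot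
  have heq : ∀ i ∈ K, (cls col U i).card = 56 := by
    have h1 : ∑ i ∈ K, (cls col U i).card = ∑ i ∈ K, 56 := by
      rw [Finset.sum_const, smul_eq_mul, hK]; omega
    exact (Finset.sum_eq_sum_iff_of_le hle).1 h1
  obtain ⟨v, hv⟩ : U.Nonempty := Finset.card_pos.1 (by omega)
  have hd := tot_deg col K U hv
  rw [hU, show Nat.choose 16 3 = 560 from rfl, show Nat.choose (16 - 1) 3 = 455 from rfl] at hd
  have hm0 : deg (mis col U K) v ≤ (mis col U K).card := Finset.card_filter_le _ _
  have hev : Even (∑ i ∈ K, deg (cls col U i) v) :=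
    Finset.even_sum _ fun i hi => (T i hi (by rw [heq i hi]; omega)).2 v
  obtain ⟨r, hr⟩ := hev
  omega

theorem step13 {col : Finset V → C} (hP : ∀ U i, PF (cls col U i)) (h : St col 13 7 6) :
    St col 12 6 7 := by
  obtain ⟨U, K, hU, hK, hm⟩ := h
  by_cases hs : ∃ i ∈ K, ∃ v ∈ U, ((cls col U i).filter (v ∉ ·)).card ≤ 1
  · obtain ⟨i, hi, v, hv, hl⟩ := hs
    exact descend hU hK hm hi hv hl
  exfalso
  push Not at hs
  have T : ∀ i ∈ K, 39 < (cls col U i).card → (cls col U i).card = 40 ∧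
      ∀ v, deg (cls col U i) v = 0 ∨ deg (cls col U i) v = 10 := by
    intro i hi hc
    rcases T13 (hP U i) (cls_sub col U i) hU hc with ⟨v, hv, h⟩ | h
    · have := hs i hi v hv; omega
    · exact h
  have hle : ∀ i ∈ K, (cls col U i).card ≤ 40 := by
    intro i hi
    by_contra hlt
    have := (T i hi (by omega)).1
    omega
  have htot := tot_card col K U
  rw [hU, show Nat.choose 13 3 = 286 from rfl] at htot
  have heq : ∀ i ∈ K, (cls col U i).card = 40 := by
    have h0 := Finset.sum_le_sum hle
    have h1 : ∑ i ∈ K, (cls col U i).card = ∑ i ∈ K, 40 := by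
      rw [Finset.sum_const, smul_eq_mul, hK] at h0 ⊢; omega
    exact (Finset.sum_eq_sum_iff_of_le hle).1 h1
  obtain ⟨v, hv, hv1⟩ : ∃ v ∈ U, deg (mis col U K) v ≤ 1 := by
    by_contra hno
    push Not at hno
    have h1 : ∑ v ∈ U, 2 ≤ ∑ v ∈ U, deg (mis col U K) v := Finset.sum_le_sum hno
    rw [deg_sum (U := U), Finset.sum_const, smul_eq_mul, hU] at h1
    · omega
    · intro e he; exact (Finset.mem_powersetCard.1 (Finset.mem_filter.1 he).1).2
    · intro e he; exact (Finset.mem_powersetCard.1 (Finset.mem_filter.1 he).1).1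
  have hd := tot_deg col K U hv
  rw [hU, show Nat.choose 13 3 = 286 from rfl, show Nat.choose (13 - 1) 3 = 220 from rfl] at hd
  have hev : 10 ∣ ∑ i ∈ K, deg (cls col U i) v := by
    apply Finset.dvd_sum
    intro i hi
    rcases (T i hi (by rw [heq i hi]; omega)).2 v with h | h <;> rw [h]
    exact dvd_zero _
  omega

theorem step12 {col : Finset V → C} (hP : ∀ U i, PF (cls col U i)) (h : St col 12 6 7) :
    St col 11 5 7 := by
  obtain ⟨U, K, hU, hK, hm⟩ := h
  by_cases hs : ∃ i ∈ K, ∃ v ∈ U, ((cls col U i).filter (v ∉ ·)).card ≤ 0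
  · obtain ⟨i, hi, v, hv, hl⟩ := hs
    exact descend hU hK hm hi hv hl
  exfalso
  push Not at hs
  have T : ∀ i, ∃ S : Finset V, i ∈ K → 32 < (cls col U i).card →
      (S ⊆ U ∧ S.card = 6) ∧ ∀ e ∈ cls col U i, e ⊆ S ∨ Disjoint e S := by
    intro i
    by_cases hc : i ∈ K ∧ 32 < (cls col U i).card
    · rcases T12 (hP U i) (cls_sub col U i) hU hc.2 with ⟨v, hv, h⟩ | ⟨S, h1, h2, h3⟩
      · have := hs i hc.1 v hv; omega
      · exact ⟨S, fun _ _ => ⟨⟨h1, h2⟩, h3⟩⟩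
    · exact ⟨∅, fun h1 h2 => absurd ⟨h1, h2⟩ hc⟩
  choose S hS using T
  set Q := K.filter (fun i => 32 < (cls col U i).card) with hQ
  set Q' := K.filter (fun i => ¬ 32 < (cls col U i).card) with hQ'
  have hQp : ∀ i ∈ Q, i ∈ K ∧ 32 < (cls col U i).card := by
    intro i hi; rw [hQ, Finset.mem_filter] at hi; exact hi
  have hcard : Q.card + Q'.card = 6 := by
    rw [hQ, hQ', Finset.card_filter_add_card_filter_not, hK]
  have hub := union_bound hU Q S (fun i hi => (hS i (hQp i hi).1 (hQp i hi).2).1) (by omega)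
  have htot := tot_card col K U
  rw [hU, show Nat.choose 12 3 = 220 from rfl,
    ← Finset.sum_filter_add_sum_filter_not K (fun i => 32 < (cls col U i).card), ← hQ, ← hQ'] at htot
  have h1 : ∑ i ∈ Q', (cls col U i).card ≤ ∑ i ∈ Q', 32 := by
    apply Finset.sum_le_sum
    intro i hi
    rw [hQ', Finset.mem_filter] at hi
    omega
  have h2 : ∑ i ∈ Q, (cls col U i).card ≤ (Q.biUnion (fun i => DD U (S i))).card := by
    rw [← Finset.card_biUnion]
    · apply Finset.card_le_card
      intro e he
      rw [Finset.mem_biUnion] at he ⊢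
      obtain ⟨i, hi, hie⟩ := he
      refine ⟨i, hi, ?_⟩
      rw [mem_DD]
      refine ⟨(hP U i).1 e hie, ?_⟩
      rcases (hS i (hQp i hi).1 (hQp i hi).2).2 e hie with h | h
      · exact Or.inl h
      · exact Or.inr (Finset.subset_sdiff.2 ⟨cls_sub col U i e hie, h⟩)
    · intro i _ j _ hij
      change Disjoint (cls col U i) (cls col U j)
      rw [Finset.disjoint_left]
      intro e h1 h2
      rw [cls, Finset.mem_filter] at h1 h2
      exact hij (h1.2.symm.trans h2.2)
  rw [Finset.sum_const, smul_eq_mul] at h1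
  omega

theorem upper {col : Finset V → C} (hP : ∀ U i, PF (cls col U i)) (h : St col 16 10 0) : False := by
  have h15 := step16 hP h
  have h14 : St col 14 8 5 := easy hP h15 (B := 50) (by decide) fun H U a b c d => T15 a b c d
  have h13 : St col 13 7 6 := easy hP h14 (B := 44) (by decide) fun H U a b c d => T14 a b c d
  have h12 := step13 hP h13
  have h11 := step12 hP h12
  have h10 : St col 10 4 7 := easy hP h11 (B := 31) (by decide) fun H U a b c d => T11 a b c d
  have h9 : St col 9 3 7 := easy hP h10 (B := 28) (by decide) fun H U a b c d => T10 a b c d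
  have h8 : St col 8 2 7 := easy hP h9 (B := 25) (by decide) fun H U a b c d => T9 a b c d
  obtain ⟨U, K, hU, hK, hm⟩ := h8
  obtain ⟨i, hi, hc⟩ := big (B := 24) hK hm (by rw [hU]; decide)
  have := T8 (hP U i) (cls_sub col U i) hU
  omega
end LP

theorem LP.lower (n : ℕ) (h : ramseyProp n 10) : 16 ≤ n := by
  by_contra hn
  obtain ⟨a, b, c, d, e, f, g, hnd, h1, h2⟩ := h (fun s => if hs : s.Nonempty then
    ⟨min (s.min' hs).val 9, by omega⟩ else 0)
  have h3 := h1.trans h2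
  simp only [Finset.insert_nonempty, dif_pos, Fin.mk.injEq] at h1 h2 h3
  set m1 := Finset.min' {a, b, c} (Finset.insert_nonempty _ _) with hm1
  set m2 := Finset.min' {c, d, e} (Finset.insert_nonempty _ _) with hm2
  set m3 := Finset.min' {e, f, g} (Finset.insert_nonempty _ _) with hm3
  have k1 : m1 ∈ ({a, b, c} : Finset (Fin n)) := Finset.min'_mem _ _
  have k3 : m3 ∈ ({e, f, g} : Finset (Fin n)) := Finset.min'_mem _ _
  have l1 : ∀ t ∈ ({a, b, c} : Finset (Fin n)), m1 ≤ t := fun t ht => Finset.min'_le _ _ ht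
  have l2 : ∀ t ∈ ({c, d, e} : Finset (Fin n)), m2 ≤ t := fun t ht => Finset.min'_le _ _ ht
  have l3 : ∀ t ∈ ({e, f, g} : Finset (Fin n)), m3 ≤ t := fun t ht => Finset.min'_le _ _ ht
  by_cases h9 : m1.val < 9
  · have : m1 = m3 := by ext; omega
    rw [this] at k1
    simp only [Finset.mem_insert, Finset.mem_singleton] at k1 k3
    clear * - hnd k1 k3
    simp at hnd
    grind
  · have q : ([a, b, c, d, e, f, g].map (fun t : Fin n => t.val)).Nodup :=
      List.Nodup.map Fin.val_injective hnd
    have hsub : ([a, b, c, d, e, f, g].map (fun t : Fin n => t.val)).toFinset ⊆ Finset.Ico 9 15 := by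
      intro t ht
      rw [List.mem_toFinset, List.mem_map] at ht
      obtain ⟨s, hs, rfl⟩ := ht
      rw [Finset.mem_Ico]
      refine ⟨?_, by have := s.isLt; omega⟩
      have : m1 ≤ s ∨ m2 ≤ s ∨ m3 ≤ s := by
        simp only [List.mem_cons, List.not_mem_nil, or_false] at hs
        rcases hs with rfl | rfl | rfl | rfl | rfl | rfl | rfl
        · exact Or.inl (l1 _ (by simp))
        · exact Or.inl (l1 _ (by simp))
        · exact Or.inl (l1 _ (by simp))
        · exact Or.inr (Or.inl (l2 _ (by simp)))
        · exact Or.inr (Or.inl (l2 _ (by simp)))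
        · exact Or.inr (Or.inr (l3 _ (by simp)))
        · exact Or.inr (Or.inr (l3 _ (by simp)))
      simp only [Fin.le_def] at this
      omega
    have := Finset.card_le_card hsub
    rw [List.toFinset_card_of_nodup q] at this
    simp at this

/-- `R(P;10) = 16`. -/
theorem ramsey_loose_path_ten_colors : IsLeast {n : ℕ | ramseyProp n 10} 16 := by
  refine ⟨?_, fun n hn => LP.lower n hn⟩
  intro col
  by_contra hno
  apply LP.upper (col := col)
  · intro U i
    refine ⟨fun e he => (Finset.mem_powersetCard.1 (Finset.mem_filter.1 he).1).2, ?_⟩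
    intro a b c d e f g hn h1 h2 h3
    have q1 := (Finset.mem_filter.1 h1).2
    have q2 := (Finset.mem_filter.1 h2).2
    have q3 := (Finset.mem_filter.1 h3).2
    exact hno ⟨a, b, c, d, e, f, g, hn, q1.trans q2.symm, q2.trans q3.symm⟩
  · exact ⟨Finset.univ, Finset.univ, by simp, by simp, by simp [LP.mis]⟩
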